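/- arXiv:2512.17767 — 2 statements merged into one kernel-verified Lean document; each statement's English description precedes it below -/
import Mathlib

section
/- Let (u, θ) be a smooth solution of the thermoelastic system. Then for every t > 0 one has the entropy identity d/dt ∫_Ω log θ(t,x) dx = ∫_Ω |∇ log θ(t,x)|² dx, and moreover for every t > 0 the bound ∫₀^t ∫_Ω |∇ log θ(s,x)|² dx ds ≤ (1/2)∫_Ω |v₀|² dx + ((2μ+λ)/2)∫_Ω (div u₀)² dx + (μ/2)∫_Ω |curl u₀|² dx + ∫_Ω (θ₀ − log θ₀) dx holds. -/
open MeasureTheory Real Filter Set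
open scoped Topology

noncomputable section

/-- Euclidean space `ℝ^d`. -/
abbrev Ed (d : ℕ) := EuclideanSpace ℝ (Fin d)

/-- Partial derivative of a scalar function in the `i`-th coordinate direction. -/
def pd {d : ℕ} (i : Fin d) (f : Ed d → ℝ) (x : Ed d) : ℝ :=
  fderiv ℝ f x (EuclideanSpace.single i 1)

/-- Divergence of a vector field. -/
def divg {d : ℕ} (w : Ed d → Ed d) (x : Ed d) : ℝ :=
  ∑ i, pd i (fun y => w y i) x

/-- Laplacian of a scalar function. -/
def lap {d : ℕ} (f : Ed d → ℝ) (x : Ed d) : ℝ :=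
  ∑ i, pd i (fun y => pd i f y) x

/-- Squared euclidean norm of the gradient of a scalar function. -/
def gradNormSq {d : ℕ} (f : Ed d → ℝ) (x : Ed d) : ℝ :=
  ∑ i, (pd i f x) ^ 2

/-- Squared Frobenius norm of the Hessian of a scalar function. -/
def hessNormSq {d : ℕ} (f : Ed d → ℝ) (x : Ed d) : ℝ :=
  ∑ i, ∑ j, (pd i (fun y => pd j f y) x) ^ 2

/-- The antisymmetric curl two-form `(curl w)ᵢⱼ = ∂ᵢ wⱼ - ∂ⱼ wᵢ`. -/
def curlM {d : ℕ} (w : Ed d → Ed d) (x : Ed d) (i j : Fin d) : ℝ :=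
  pd i (fun y => w y j) x - pd j (fun y => w y i) x

/-- `|curl w|²`: in dimension 2 (scalar curl) and 3 (vector curl) this equals
the squared norm of the curl. -/
def curlNormSq {d : ℕ} (w : Ed d → Ed d) (x : Ed d) : ℝ :=
  (1 / 2) * ∑ i, ∑ j, (curlM w x i j) ^ 2

/-- `j`-th component of `curl curl w` (in dimensions 2 and 3 this is
`∑ i ∂ᵢ (∂ⱼ wᵢ - ∂ᵢ wⱼ) = ∂ⱼ (div w) - Δ wⱼ`). -/
def ccurl {d : ℕ} (w : Ed d → Ed d) (x : Ed d) (j : Fin d) : ℝ :=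
  ∑ i, pd i (fun y => curlM w y j i) x

/-- `j`-th component of the componentwise Laplacian of a vector field. -/
def veclap {d : ℕ} (w : Ed d → Ed d) (x : Ed d) (j : Fin d) : ℝ :=
  ∑ i, pd i (fun y => pd i (fun z => w z j) y) x

/-- Time derivative of a time-dependent field. -/
def tder {α : Type*} {F : Type*} [NormedAddCommGroup F] [NormedSpace ℝ F]
    (u : ℝ → α → F) : ℝ → α → F :=
  fun t x => deriv (fun s => u s x) t

/-- An open, bounded, convex domain in `ℝ^d` (`d ∈ {2,3}`) together with its outward
unit normal field `n` on the boundary.  For a convex body with smooth boundary the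
outward unit normal at a boundary point is characterized by the supporting
half-space inequality. -/
structure GoodDomain (d : ℕ) (Ω : Set (Ed d)) (n : Ed d → Ed d) : Prop where
  dims : d = 2 ∨ d = 3
  isOpen : IsOpen Ω
  bounded : Bornology.IsBounded Ω
  convex : Convex ℝ Ω
  nonempty : Ω.Nonempty
  normal_unit : ∀ x ∈ frontier Ω, ‖n x‖ = 1
  normal_outward : ∀ x ∈ frontier Ω, ∀ y ∈ closure Ω, ∑ i, (y i - x i) * n x i ≤ 0

/-- A smooth solution `(u, θ)` of the thermoelastic system
`u_tt - (2μ+λ)∇(div u) + μ curl curl u = -ν∇θ`, `θ_t - Δθ = -ν θ div u_t`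
with boundary conditions `u·n = 0`, `𝒩u = 0` (encoded as `(curl u) n = 0`,
which in dimension 2 means `curl u = 0` and in dimension 3 means
`curl u × n = 0`) and `∇θ·n = 0`, and with positive temperature. -/
structure IsSolution {d : ℕ} (Ω : Set (Ed d)) (n : Ed d → Ed d)
    (μ lam ν : ℝ) (u : ℝ → Ed d → Ed d) (θ : ℝ → Ed d → ℝ) : Prop where
  smooth_u : ContDiff ℝ (⊤ : ℕ∞) (fun p : ℝ × Ed d => u p.1 p.2)
  smooth_θ : ContDiff ℝ (⊤ : ℕ∞) (fun p : ℝ × Ed d => θ p.1 p.2)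
  theta_pos : ∀ t : ℝ, 0 ≤ t → ∀ x ∈ closure Ω, 0 < θ t x
  wave : ∀ t : ℝ, 0 < t → ∀ x ∈ Ω, ∀ j : Fin d,
    tder (tder u) t x j - (2 * μ + lam) * pd j (divg (u t)) x
      + μ * ccurl (u t) x j = -ν * pd j (θ t) x
  heat : ∀ t : ℝ, 0 < t → ∀ x ∈ Ω,
    tder θ t x - lap (θ t) x = -ν * θ t x * divg (tder u t) x
  bc_u : ∀ t : ℝ, 0 < t → ∀ x ∈ frontier Ω, ∑ i, u t x i * n x i = 0
  bc_N : ∀ t : ℝ, 0 < t → ∀ x ∈ frontier Ω, ∀ i : Fin d,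
    ∑ j, curlM (u t) x i j * n x j = 0
  bc_θ : ∀ t : ℝ, 0 < t → ∀ x ∈ frontier Ω, ∑ i, pd i (θ t) x * n x i = 0

/-- The functional `F(u, u_t, θ)` built from the Fisher information and
higher-order derivatives of the displacement. -/
def Ffun {d : ℕ} (Ω : Set (Ed d)) (μ lam : ℝ)
    (u : ℝ → Ed d → Ed d) (θ : ℝ → Ed d → ℝ) (t : ℝ) : ℝ :=
  (1 / 2) * ((∫ x in Ω, (divg (tder u t) x) ^ 2)
    + (∫ x in Ω, curlNormSq (tder u t) x)
    + (2 * μ + lam) * (∫ x in Ω, gradNormSq (divg (u t)) x)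
    + μ * (∫ x in Ω, ∑ j, (ccurl (u t) x j) ^ 2)
    + (∫ x in Ω, gradNormSq (θ t) x / θ t x))

/-- The small-data condition
`‖div v₀‖² + ‖curl v₀‖² + (2μ+λ)‖∇div u₀‖² + μ‖curl curl u₀‖² + ‖∇θ₀/√θ₀‖² ≤ D`. -/
def smallData {d : ℕ} (Ω : Set (Ed d)) (μ lam : ℝ)
    (u0 v0 : Ed d → Ed d) (θ0 : Ed d → ℝ) (D : ℝ) : Prop :=
  (∫ x in Ω, (divg v0 x) ^ 2) + (∫ x in Ω, curlNormSq v0 x)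
    + (2 * μ + lam) * (∫ x in Ω, gradNormSq (divg u0) x)
    + μ * (∫ x in Ω, ∑ j, (ccurl u0 x j) ^ 2)
    + (∫ x in Ω, gradNormSq θ0 x / θ0 x) ≤ D

/-- The norm `‖w‖_H = (‖div w‖² + ‖curl w‖²)^{1/2}`. -/
def Hnorm {d : ℕ} (Ω : Set (Ed d)) (w : Ed d → Ed d) : ℝ :=
  Real.sqrt ((∫ x in Ω, (divg w x) ^ 2) + (∫ x in Ω, curlNormSq w x))

end

section Divergence

/-- The cutoff `min 1 (k (1 - gauge S))`, truncated below at `0`. -/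
noncomputable def gaugeCutoff {d : ℕ} (S : Set (Ed d)) (k : ℝ) (x : Ed d) : ℝ :=
  max 0 (min 1 (k * (1 - gauge S x)))

variable {d : ℕ} {S : Set (Ed d)}

lemma gaugeCutoff_nonneg (k : ℝ) (x : Ed d) : 0 ≤ gaugeCutoff S k x := le_max_left _ _

lemma gaugeCutoff_le_one (k : ℝ) (x : Ed d) : gaugeCutoff S k x ≤ 1 :=
  max_le zero_le_one (min_le_left _ _)

lemma gaugeCutoff_eq_zero {k : ℝ} (hk : 0 ≤ k) (hc : Convex ℝ S) (h0 : (0 : Ed d) ∈ S)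
    (ho : IsOpen S) {x : Ed d} (hx : x ∉ S) : gaugeCutoff S k x = 0 := by
  have h : 1 ≤ gauge S x := by
    by_contra! h
    exact hx (by rw [← setOfPred_gauge_lt_one_eq_self_of_isOpen hc h0 ho]; exact h)
  have : k * (1 - gauge S x) ≤ 0 := mul_nonpos_of_nonneg_of_nonpos hk (by linarith)
  exact max_eq_left ((min_le_right _ _).trans this)

lemma gaugeCutoff_lipschitz {k : ℝ} (hk : 0 ≤ k) {L : NNReal} (hL : LipschitzWith L (gauge S)) :
    LipschitzWith (k.toNNReal * L) (gaugeCutoff S k) := by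
  have h1 : LipschitzWith (k.toNNReal * L) (fun x => k * (1 - gauge S x)) := by
    refine LipschitzWith.of_dist_le_mul fun x y => ?_
    have := hL.dist_le_mul x y
    rw [Real.dist_eq] at this ⊢
    have e : k * (1 - gauge S x) - k * (1 - gauge S y) = -(k * (gauge S x - gauge S y)) := by ring
    rw [e, abs_neg, abs_mul, abs_of_nonneg hk, NNReal.coe_mul, Real.coe_toNNReal k hk, mul_assoc]
    exact mul_le_mul_of_nonneg_left this hk
  exact (h1.const_min 1).const_max 0

lemma gaugeCutoff_tendsto (hc : Convex ℝ S) (h0 : (0 : Ed d) ∈ S)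
    (ho : IsOpen S) (x : Ed d) :
    ∀ᶠ k : ℕ in atTop, gaugeCutoff S ((k : ℝ) + 2) x = S.indicator 1 x := by
  by_cases hx : x ∈ S
  · have hg : gauge S x < 1 := gauge_lt_one_of_mem_of_isOpen ho hx
    have hd : 0 < 1 - gauge S x := by linarith
    obtain ⟨N, hN⟩ := exists_nat_gt (1 / (1 - gauge S x))
    filter_upwards [eventually_ge_atTop N] with k hk
    have hk' : (N : ℝ) ≤ k := by exact_mod_cast hk
    have : 1 ≤ ((k : ℝ) + 2) * (1 - gauge S x) := by
      rw [div_lt_iff₀ hd] at hN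
      nlinarith
    rw [indicator_of_mem hx, gaugeCutoff, min_eq_left this]
    simp
  · filter_upwards with k
    rw [indicator_of_notMem hx, gaugeCutoff_eq_zero (by positivity) hc h0 ho hx]

/-- A supporting functional at a point of the frontier of a convex neighbourhood of the origin
bounds the gauge from below. -/
lemma le_gauge_of_support (ho : IsOpen S) (h0 : (0 : Ed d) ∈ S)
    {ℓ : Ed d →L[ℝ] ℝ} {c : ℝ} (hc : 0 < c) (hle : ∀ y ∈ S, ℓ y ≤ c) (z : Ed d) :
    ℓ z / c ≤ gauge S z := by
  by_contra! h
  obtain ⟨b, hb, hbc, hz⟩ := exists_lt_of_gauge_lt (absorbent_nhds_zero (ho.mem_nhds h0)) h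
  obtain ⟨s, hs, rfl⟩ := hz
  rw [lt_div_iff₀ hc] at hbc
  simp only [map_smul, smul_eq_mul] at hbc
  have := hle s hs
  nlinarith

lemma support_pos (ho : IsOpen S) (h0 : (0 : Ed d) ∈ S)
    {ℓ : Ed d →L[ℝ] ℝ} (hℓ : ℓ ≠ 0) {c : ℝ} (hle : ∀ y ∈ S, ℓ y ≤ c) : 0 < c := by
  obtain ⟨v, hv⟩ : ∃ v, ℓ v ≠ 0 := by
    by_contra! h
    exact hℓ (ContinuousLinearMap.ext h)
  obtain ⟨w, hw⟩ : ∃ w, 0 < ℓ w := by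
    rcases lt_or_gt_of_ne hv with h | h
    · exact ⟨-v, by simpa using h⟩
    · exact ⟨v, h⟩
  have hcont : Tendsto (fun t : ℝ => t • w) (𝓝[>] 0) (𝓝 0) := by
    have : Continuous (fun t : ℝ => t • w) := by fun_prop
    simpa using (this.tendsto 0).mono_left nhdsWithin_le_nhds
  obtain ⟨t, htS, ht⟩ := ((hcont.eventually (ho.mem_nhds h0)).and self_mem_nhdsWithin).exists
  have := hle _ htS
  simp only [map_smul, smul_eq_mul] at this
  exact (mul_pos ht hw).trans_le this

/-- The derivative of the cutoff along a field tangent to the frontier stays bounded, uniformly in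
the steepness of the cutoff. -/
lemma fderiv_gaugeCutoff_bound (hc : Convex ℝ S) (ho : IsOpen S) (h0 : (0 : Ed d) ∈ S)
    {R : ℝ} (hR : ∀ x ∈ S, ‖x‖ ≤ R) {L M : NNReal} (hL : LipschitzWith L (gauge S))
    {W : Ed d → Ed d} (hM : LipschitzWith M W)
    (hW : ∀ x ∈ frontier S, ∃ ℓ : Ed d →L[ℝ] ℝ, ℓ ≠ 0 ∧ (∀ y ∈ S, ℓ y ≤ ℓ x) ∧ ℓ (W x) = 0)
    {k : ℝ} (hk : 2 ≤ k) {x : Ed d} (hd : DifferentiableAt ℝ (gaugeCutoff S k) x)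
    (hx0 : gaugeCutoff S k x ≠ 0) (hx1 : gaugeCutoff S k x ≠ 1) :
    |fderiv ℝ (gaugeCutoff S k) x (W x)| ≤ 2 * L * M * R := by
  have hk0 : 0 < k := by linarith
  have hgc : Continuous (gauge S) := hL.continuous
  have hxS : x ∈ S := by
    by_contra h
    exact hx0 (gaugeCutoff_eq_zero hk0.le hc h0 ho h)
  have hpos : 0 < k * (1 - gauge S x) := by
    by_contra! h
    exact hx0 (max_eq_left ((min_le_right _ _).trans h))
  have hlt : k * (1 - gauge S x) < 1 := by
    by_contra! h
    refine hx1 ?_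
    rw [gaugeCutoff, min_eq_left h]
    simp
  have hg1 : gauge S x < 1 := by
    by_contra! h
    nlinarith
  have hghalf : 1 / 2 < gauge S x := by
    by_contra! h
    nlinarith
  have hg0 : 0 < gauge S x := by linarith
  set g := gauge S x with hg
  set y : Ed d := g⁻¹ • x with hy
  have hxy : x = g • y := by rw [hy, smul_smul, mul_inv_cancel₀ hg0.ne', one_smul]
  have hyfr : y ∈ frontier S := by
    rw [← gauge_eq_one_iff_mem_frontier hc (ho.mem_nhds h0), hy,
      gauge_smul_of_nonneg (inv_nonneg.2 hg0.le), ← hg, smul_eq_mul, inv_mul_cancel₀ hg0.ne']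
  obtain ⟨ℓ, hℓ0, hℓ, hℓW⟩ := hW y hyfr
  have hcp : 0 < ℓ y := support_pos ho h0 hℓ0 hℓ
  have hmax : IsLocalMax (fun z => gaugeCutoff S k z + k * (ℓ z / ℓ y)) x := by
    have hev : ∀ᶠ z in 𝓝 x, 0 < k * (1 - gauge S z) ∧ k * (1 - gauge S z) < 1 := by
      have hcont : Continuous fun z => k * (1 - gauge S z) := by fun_prop
      exact (hcont.tendsto x).eventually (Ioo_mem_nhds hpos hlt)
    have hform : ∀ z, (0 < k * (1 - gauge S z) ∧ k * (1 - gauge S z) < 1) →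
        gaugeCutoff S k z = k * (1 - gauge S z) := fun z hz => by
      rw [gaugeCutoff, min_eq_right hz.2.le, max_eq_right hz.1.le]
    filter_upwards [hev] with z hz
    rw [hform z hz, hform x ⟨hpos, hlt⟩]
    have h1 := le_gauge_of_support ho h0 hcp hℓ z
    have h2 : ℓ x / ℓ y = g := by
      conv_lhs => rw [hxy]
      simp [hcp.ne']
    rw [h2, ← hg]
    nlinarith
  have hder : HasFDerivAt (fun z => gaugeCutoff S k z + k * (ℓ z / ℓ y))
      (fderiv ℝ (gaugeCutoff S k) x + (k * (ℓ y)⁻¹) • ℓ) x := by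
    refine hd.hasFDerivAt.add ?_
    have := (ℓ.hasFDerivAt (x := x)).const_mul (k * (ℓ y)⁻¹)
    refine this.congr_of_eventuallyEq (Eventually.of_forall fun z => ?_)
    simp only [div_eq_mul_inv]
    ring
  have hzero := hmax.hasFDerivAt_eq_zero hder
  have hWy : fderiv ℝ (gaugeCutoff S k) x (W y) = 0 := by
    have := congrArg (fun T : Ed d →L[ℝ] ℝ => T (W y)) hzero
    simpa [hℓW] using this
  have hsub : fderiv ℝ (gaugeCutoff S k) x (W x)
      = fderiv ℝ (gaugeCutoff S k) x (W x - W y) := by rw [map_sub, hWy, sub_zero]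
  have hxy' : ‖x - y‖ ≤ 2 * R / k := by
    have e : x - y = (1 - g⁻¹) • x := by rw [hy, sub_smul, one_smul]
    have h1 : g⁻¹ - 1 ≤ 2 / k := by
      rw [le_div_iff₀ hk0]
      have : g⁻¹ - 1 = (1 - g) * g⁻¹ := by field_simp
      have h2 : g⁻¹ ≤ 2 := by
        rw [inv_le_comm₀ hg0 two_pos]; linarith
      have h3 : 0 < g⁻¹ := inv_pos.2 hg0
      rw [this]
      nlinarith
    have h2 : 0 ≤ g⁻¹ - 1 := by
      have := one_le_inv₀ hg0 |>.2 hg1.le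
      linarith
    rw [e, norm_smul, Real.norm_eq_abs, abs_sub_comm, abs_of_nonneg h2]
    calc (g⁻¹ - 1) * ‖x‖ ≤ (2 / k) * R :=
          mul_le_mul h1 (hR x hxS) (norm_nonneg _) (by positivity)
      _ = 2 * R / k := by ring
  have hn : ‖fderiv ℝ (gaugeCutoff S k) x‖ ≤ k * L := by
    have := norm_fderiv_le_of_lipschitz ℝ (gaugeCutoff_lipschitz hk0.le hL) (x₀ := x)
    simpa [Real.coe_toNNReal k hk0.le] using this
  rw [hsub, ← Real.norm_eq_abs]
  calc ‖fderiv ℝ (gaugeCutoff S k) x (W x - W y)‖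
      ≤ ‖fderiv ℝ (gaugeCutoff S k) x‖ * ‖W x - W y‖ := ContinuousLinearMap.le_opNorm _ _
    _ ≤ (k * L) * (M * (2 * R / k)) := by
        refine mul_le_mul hn ?_ (norm_nonneg _) (by positivity)
        have := hM.dist_le_mul x y
        rw [dist_eq_norm, dist_eq_norm] at this
        exact this.trans (mul_le_mul_of_nonneg_left hxy' M.2)
    _ = 2 * L * M * R := by field_simp

/-- Where the cutoff takes an extreme value its derivative vanishes. -/
lemma fderiv_gaugeCutoff_eq_zero {k : ℝ} {x : Ed d}
    (h : gaugeCutoff S k x = 0 ∨ gaugeCutoff S k x = 1) : fderiv ℝ (gaugeCutoff S k) x = 0 := by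
  rcases h with h | h
  · refine IsLocalMin.fderiv_eq_zero (Eventually.of_forall fun z => ?_)
    rw [h]
    exact gaugeCutoff_nonneg k z
  · refine IsLocalMax.fderiv_eq_zero (Eventually.of_forall fun z => ?_)
    rw [h]
    exact gaugeCutoff_le_one k z

lemma ed_sum_single (v : Ed d) : ∑ i, v i • EuclideanSpace.single i (1 : ℝ) = v := by
  ext j
  simp [Finset.sum_apply, Pi.single_apply]

/-- The divergence theorem for a compactly supported field tangent to the frontier of a convex set
containing the origin. -/
lemma integral_divg_eq_zero_of_zero_mem (hc : Convex ℝ S) (ho : IsOpen S) (h0 : (0 : Ed d) ∈ S)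
    (hb : Bornology.IsBounded S) {W : Ed d → Ed d} (hWd : ContDiff ℝ 1 W)
    (hWc : HasCompactSupport W)
    (hW : ∀ x ∈ frontier S, ∃ ℓ : Ed d →L[ℝ] ℝ, ℓ ≠ 0 ∧ (∀ y ∈ S, ℓ y ≤ ℓ x) ∧ ℓ (W x) = 0) :
    ∫ x in S, divg W x = 0 := by
  obtain ⟨R, hR⟩ := hb.exists_norm_le
  obtain ⟨r, hr, hball⟩ := Metric.isOpen_iff.1 ho 0 h0
  have hL : LipschitzWith (⟨r, hr.le⟩ : NNReal)⁻¹ (gauge S) := hc.lipschitzWith_gauge hr hball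
  set L : NNReal := (⟨r, hr.le⟩ : NNReal)⁻¹
  obtain ⟨M, hM⟩ := hWd.lipschitzWith_of_hasCompactSupport hWc one_ne_zero
  have hWi : ∀ i, LipschitzWith M (fun x => W x i) := fun i =>
    LipschitzWith.of_dist_le_mul fun x y => by
      refine le_trans ?_ (hM.dist_le_mul x y)
      rw [Real.dist_eq, dist_eq_norm]
      simpa using PiLp.norm_apply_le (W x - W y) i
  have hWid : ∀ i, ContDiff ℝ 1 (fun x => W x i) := contDiff_euclidean.1 hWd
  have hR0 : 0 ≤ R := (norm_nonneg _).trans (hR 0 h0)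
  have hvol : volume S < ⊤ := hb.measure_lt_top
  have hpdc : ∀ i, Continuous (pd i (fun x => W x i)) := fun i =>
    ((hWid i).continuous_fderiv one_ne_zero).clm_apply continuous_const
  have hdivc : Continuous (divg W) := continuous_finsetSum _ fun i _ => hpdc i
  have hcutc : ∀ k : ℝ, 0 ≤ k → HasCompactSupport (gaugeCutoff S k) := fun k hk =>
    HasCompactSupport.intro hb.isCompact_closure fun x hx =>
      gaugeCutoff_eq_zero hk hc h0 ho fun h => hx (subset_closure h)
  have key : ∀ k : ℝ, 2 ≤ k → ∫ x, divg W x * gaugeCutoff S k x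
      = ∫ x, -(fderiv ℝ (gaugeCutoff S k) x (W x)) := by
    intro k hk
    have hk0 : 0 ≤ k := by linarith
    have hlip := gaugeCutoff_lipschitz hk0 hL
    have hcs := hcutc k hk0
    have h1 : ∀ i, ∫ x, pd i (fun y => W y i) x * gaugeCutoff S k x
        = ∫ x, -(fderiv ℝ (gaugeCutoff S k) x (EuclideanSpace.single i 1)) * W x i := by
      intro i
      have h := (hWi i).integral_lineDeriv_mul_eq (μ := volume) hlip hcs
        (EuclideanSpace.single i 1)
      rw [show (fun x => pd i (fun y => W y i) x * gaugeCutoff S k x) = fun x =>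
        lineDeriv ℝ (fun x => W x i) x (EuclideanSpace.single i 1) * gaugeCutoff S k x from ?_, h]
      · refine integral_congr_ae ?_
        filter_upwards [hlip.ae_differentiableAt (μ := volume)] with x hx
        rw [hx.lineDeriv_eq_fderiv, map_neg]
      · funext x
        rw [(((hWid i).differentiable one_ne_zero) x).lineDeriv_eq_fderiv]
        rfl
    have hint1 : ∀ i, Integrable fun x => pd i (fun y => W y i) x * gaugeCutoff S k x := fun i =>
      ((hpdc i).mul hlip.continuous).integrable_of_hasCompactSupport hcs.mul_left
    have hint2 : ∀ i, Integrable fun x =>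
        -(fderiv ℝ (gaugeCutoff S k) x (EuclideanSpace.single i 1)) * W x i := by
      intro i
      have hWint : Integrable fun x => W x i :=
        (hWid i).continuous.integrable_of_hasCompactSupport
          (hWc.comp_left (g := fun v : Ed d => v i) rfl)
      refine hWint.bdd_mul (c := k.toNNReal * L) ?_ (Eventually.of_forall fun x => ?_)
      · exact ((measurable_fderiv_apply_const ℝ _ _).neg).aestronglyMeasurable
      · rw [norm_neg]
        refine (ContinuousLinearMap.le_opNorm _ _).trans ?_
        have := norm_fderiv_le_of_lipschitz ℝ hlip (x₀ := x)
        simpa using this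
    calc ∫ x, divg W x * gaugeCutoff S k x
        = ∫ x, ∑ i, pd i (fun y => W y i) x * gaugeCutoff S k x := by
          simp only [divg, Finset.sum_mul]
      _ = ∑ i, ∫ x, pd i (fun y => W y i) x * gaugeCutoff S k x :=
          integral_finsetSum _ fun i _ => hint1 i
      _ = ∑ i, ∫ x, -(fderiv ℝ (gaugeCutoff S k) x (EuclideanSpace.single i 1)) * W x i :=
          Finset.sum_congr rfl fun i _ => h1 i
      _ = ∫ x, ∑ i, -(fderiv ℝ (gaugeCutoff S k) x (EuclideanSpace.single i 1)) * W x i :=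
          (integral_finsetSum _ fun i _ => hint2 i).symm
      _ = _ := by
          congr 1
          funext x
          conv_rhs => rw [← ed_sum_single (W x)]
          simp only [map_sum, map_smul, smul_eq_mul, ← Finset.sum_neg_distrib]
          exact Finset.sum_congr rfl fun i _ => by ring
  have lim1 : Tendsto (fun k : ℕ => ∫ x, divg W x * gaugeCutoff S ((k : ℝ) + 2) x) atTop
      (𝓝 (∫ x, divg W x * S.indicator 1 x)) := by
    refine tendsto_integral_of_dominated_convergence (fun x => S.indicator (fun x => |divg W x|) x)
      (fun k => ?_) ?_ (fun k => Eventually.of_forall fun x => ?_)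
      (Eventually.of_forall fun x => ?_)
    · exact (hdivc.mul (gaugeCutoff_lipschitz (by positivity) hL).continuous).aestronglyMeasurable
    · rw [integrable_indicator_iff ho.measurableSet]
      exact (hdivc.abs.continuousOn.integrableOn_compact hb.isCompact_closure).mono_set
        subset_closure
    · by_cases hx : x ∈ S
      · rw [indicator_of_mem hx, norm_mul, Real.norm_eq_abs, Real.norm_eq_abs,
          abs_of_nonneg (gaugeCutoff_nonneg _ _)]
        exact mul_le_of_le_one_right (abs_nonneg _) (gaugeCutoff_le_one _ _)
      · rw [indicator_of_notMem hx, gaugeCutoff_eq_zero (by positivity) hc h0 ho hx]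
        simp
    · refine tendsto_const_nhds.congr' ?_
      filter_upwards [gaugeCutoff_tendsto hc h0 ho x] with k hk
      rw [hk]
  have lim2 : Tendsto (fun k : ℕ => ∫ x, -(fderiv ℝ (gaugeCutoff S ((k : ℝ) + 2)) x (W x))) atTop
      (𝓝 (∫ _ : Ed d, (0 : ℝ))) := by
    refine tendsto_integral_of_dominated_convergence
      (fun x => S.indicator (fun _ => 2 * L * M * R) x)
      (fun k => ?_) ?_ (fun k => ?_) (Eventually.of_forall fun x => ?_)
    · refine Measurable.aestronglyMeasurable ?_
      exact (isBoundedBilinearMap_apply.continuous.measurable2 (measurable_fderiv ℝ _)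
        hWd.continuous.measurable).neg
    · rw [integrable_indicator_iff ho.measurableSet]
      exact integrableOn_const hvol.ne
    · have hlip := gaugeCutoff_lipschitz (S := S) (k := (k : ℝ) + 2) (by positivity) hL
      filter_upwards [hlip.ae_differentiableAt (μ := volume)] with x hx
      rw [norm_neg, Real.norm_eq_abs]
      by_cases h01 : gaugeCutoff S ((k : ℝ) + 2) x = 0 ∨ gaugeCutoff S ((k : ℝ) + 2) x = 1
      · rw [fderiv_gaugeCutoff_eq_zero h01]
        simpa using indicator_nonneg (fun _ _ => by positivity) x
      · push Not at h01
        have hxS : x ∈ S := by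
          by_contra h
          exact h01.1 (gaugeCutoff_eq_zero (by positivity) hc h0 ho h)
        rw [indicator_of_mem hxS]
        exact fderiv_gaugeCutoff_bound hc ho h0 hR hL hM hW (by linarith [k.cast_nonneg (α := ℝ)])
          hx h01.1 h01.2
    · refine tendsto_const_nhds.congr' ?_
      filter_upwards [gaugeCutoff_tendsto hc h0 ho x] with k hk
      rw [fderiv_gaugeCutoff_eq_zero]
      · simp
      · rw [hk]
        by_cases hx : x ∈ S <;> simp [hx]
  have heq : ∀ k : ℕ, ∫ x, divg W x * gaugeCutoff S ((k : ℝ) + 2) x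
      = ∫ x, -(fderiv ℝ (gaugeCutoff S ((k : ℝ) + 2)) x (W x)) := fun k =>
    key _ (by linarith [k.cast_nonneg (α := ℝ)])
  simp only [← heq] at lim2
  have := tendsto_nhds_unique lim1 lim2
  rw [integral_zero] at this
  rw [← this, ← integral_indicator ho.measurableSet]
  congr 1
  funext x
  by_cases hx : x ∈ S <;> simp [hx]

end Divergence

/-- The divergence theorem on a convex domain, for a field tangent to the boundary. -/
lemma GoodDomain.integral_divg_eq_zero {d : ℕ} {Ω : Set (Ed d)} {n : Ed d → Ed d}
    (hdom : GoodDomain d Ω n) {U : Set (Ed d)} (hU : IsOpen U) (hΩU : closure Ω ⊆ U)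
    {W : Ed d → Ed d} (hWd : ContDiffOn ℝ 1 W U)
    (hW : ∀ x ∈ frontier Ω, ∑ i, W x i * n x i = 0) :
    ∫ x in Ω, divg W x = 0 := by
  obtain ⟨x₀, hx₀⟩ := hdom.nonempty
  obtain ⟨R, hR⟩ := hdom.bounded.closure.subset_ball (0 : Ed d)
  set T := U ∩ Metric.ball (0 : Ed d) R with hT
  have hTo : IsOpen T := hU.inter Metric.isOpen_ball
  have hΩT : closure Ω ⊆ T := subset_inter hΩU hR
  obtain ⟨χ, hχ0, hχ1, -⟩ := exists_contMDiffMap_zero_one_nhds_of_isClosed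
    (modelWithCornersSelf ℝ (Ed d)) (n := 1) hTo.isClosed_compl (isClosed_closure (s := Ω))
    (disjoint_compl_left_iff_subset.2 hΩT)
  have hχ : ContDiff ℝ 1 χ := χ.contMDiff.contDiff
  rw [eventually_nhdsSet_iff_forall] at hχ0 hχ1
  have hV : ContDiff ℝ 1 fun x => χ x • W x := by
    refine contDiff_iff_contDiffAt.2 fun x => ?_
    by_cases hx : x ∈ T
    · exact hχ.contDiffAt.smul (hWd.contDiffAt (hU.mem_nhds hx.1))
    · refine (contDiffAt_const (c := (0 : Ed d))).congr_of_eventuallyEq ?_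
      filter_upwards [hχ0 x hx] with y hy
      rw [hy, zero_smul]
  set V : Ed d → Ed d := fun z => χ (x₀ + z) • W (x₀ + z) with hVdef
  have hVd : ContDiff ℝ 1 V := hV.comp (contDiff_const.add contDiff_id)
  have hVc : HasCompactSupport V := by
    refine HasCompactSupport.intro (K := (fun z => -x₀ + z) '' Metric.closedBall 0 R)
      ((isCompact_closedBall _ _).image (by fun_prop)) fun z hz => ?_
    have : x₀ + z ∉ T := fun h => hz ⟨x₀ + z, Metric.ball_subset_closedBall h.2, by simp⟩
    simp only [hVdef, (hχ0 _ this).self_of_nhds, zero_smul]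
  set S : Set (Ed d) := (fun z => x₀ + z) ⁻¹' Ω with hS
  have hSfr : frontier S = (fun z => x₀ + z) ⁻¹' frontier Ω :=
    ((Homeomorph.addLeft x₀).preimage_frontier Ω).symm
  have hSb : Bornology.IsBounded S := by
    obtain ⟨C, hC⟩ := hdom.bounded.exists_norm_le
    refine isBounded_iff_forall_norm_le.2 ⟨C + ‖x₀‖, fun z hz => ?_⟩
    have h1 := hC _ hz
    have h2 : ‖z‖ ≤ ‖x₀ + z‖ + ‖x₀‖ := by
      simpa using norm_sub_le (x₀ + z) x₀
    linarith
  have hzero : ∫ z in S, divg V z = 0 := by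
    refine integral_divg_eq_zero_of_zero_mem (hdom.convex.translate_preimage_right x₀)
      (hdom.isOpen.preimage (by fun_prop)) (by simpa [hS] using hx₀) hSb hVd hVc fun z hz => ?_
    rw [hSfr] at hz
    have hz' : x₀ + z ∈ frontier Ω := hz
    refine ⟨innerSL ℝ (n (x₀ + z)), fun h => ?_, fun y hy => ?_, ?_⟩
    · have h1 := hdom.normal_unit _ hz'
      have h2 : inner ℝ (n (x₀ + z)) (n (x₀ + z)) = 0 := by
        simpa using congrArg (fun T : Ed d →L[ℝ] ℝ => T (n (x₀ + z))) h
      rw [inner_self_eq_zero] at h2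
      rw [h2] at h1
      simp at h1
    · have := hdom.normal_outward _ hz' (x₀ + y) (subset_closure hy)
      rw [← sub_nonneg]
      simp only [innerSL_apply_apply, ← inner_sub_right]
      simp only [PiLp.inner_apply, RCLike.inner_apply, conj_trivial, PiLp.sub_apply]
      rw [← neg_nonpos, ← Finset.sum_neg_distrib]
      refine le_trans (le_of_eq (Finset.sum_congr rfl fun i _ => ?_)) this
      simp only [PiLp.add_apply]
      ring
    · have := hW _ hz'
      simp only [hVdef, innerSL_apply_apply, inner_smul_right]
      simp only [PiLp.inner_apply, RCLike.inner_apply, conj_trivial]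
      rw [this, mul_zero]
  have htrans := (measurePreserving_add_left (volume : Measure (Ed d)) x₀).setIntegral_preimage_emb
    (Homeomorph.addLeft x₀).measurableEmbedding (divg W) Ω
  rw [← htrans, ← hzero]
  refine setIntegral_congr_fun (hdom.isOpen.preimage (by fun_prop)).measurableSet fun z hz => ?_
  refine Finset.sum_congr rfl fun i _ => ?_
  have hev : (fun y => V y i) =ᶠ[𝓝 z] fun y => W (x₀ + y) i := by
    have hz' : x₀ + z ∈ Ω := hz
    have hcont : Tendsto (fun y => x₀ + y) (𝓝 z) (𝓝 (x₀ + z)) :=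
      (continuous_const.add continuous_id).tendsto z
    filter_upwards [hcont.eventually (hχ1 _ (subset_closure hz'))] with y hy
    simp [hVdef, hy]
  simp only [pd]
  rw [hev.fderiv_eq, fderiv_comp_add_left (f := fun y => W y i)]

section Parametric

variable {d : ℕ} {Ω : Set (Ed d)} {f f' : ℝ → Ed d → ℝ} {a b : ℝ}

lemma exists_bound_of_continuousOn (hb : Bornology.IsBounded Ω)
    (hf : ContinuousOn (fun p : ℝ × Ed d => f p.1 p.2) (Icc a b ×ˢ closure Ω)) :
    ∃ C, ∀ s ∈ Icc a b, ∀ x ∈ Ω, ‖f s x‖ ≤ C := by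
  obtain ⟨C, hC⟩ := (isCompact_Icc.prod hb.isCompact_closure).exists_bound_of_continuousOn hf
  exact ⟨C, fun s hs x hx => hC (s, x) ⟨hs, subset_closure hx⟩⟩

lemma continuousOn_slice
    (hf : ContinuousOn (fun p : ℝ × Ed d => f p.1 p.2) (Icc a b ×ˢ closure Ω)) {s : ℝ}
    (hs : s ∈ Icc a b) : ContinuousOn (f s) (closure Ω) :=
  hf.comp (f := fun x => (s, x)) (by fun_prop) fun _ hx => ⟨hs, hx⟩

lemma integrableOn_slice (hb : Bornology.IsBounded Ω)
    (hf : ContinuousOn (fun p : ℝ × Ed d => f p.1 p.2) (Icc a b ×ˢ closure Ω)) {s : ℝ}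
    (hs : s ∈ Icc a b) : IntegrableOn (f s) Ω :=
  ((continuousOn_slice hf hs).integrableOn_compact hb.isCompact_closure).mono_set subset_closure

lemma continuousOn_setIntegral (ho : IsOpen Ω) (hb : Bornology.IsBounded Ω)
    (hf : ContinuousOn (fun p : ℝ × Ed d => f p.1 p.2) (Icc a b ×ˢ closure Ω)) :
    ContinuousOn (fun s => ∫ x in Ω, f s x) (Icc a b) := by
  obtain ⟨C, hC⟩ := exists_bound_of_continuousOn hb hf
  refine continuousOn_of_dominated (bound := fun _ => C)
    (fun s hs => (integrableOn_slice hb hf hs).aestronglyMeasurable) (fun s hs => ?_)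
    (integrableOn_const hb.measure_lt_top.ne) ?_
  · exact (ae_restrict_iff' ho.measurableSet).2 (Eventually.of_forall fun x hx => hC s hs x hx)
  · refine (ae_restrict_iff' ho.measurableSet).2 (Eventually.of_forall fun x hx => ?_)
    exact hf.comp (f := fun s => (s, x)) (by fun_prop) fun _ hs => ⟨hs, subset_closure hx⟩

lemma hasDerivAt_setIntegral (ho : IsOpen Ω) (hb : Bornology.IsBounded Ω)
    (hf : ContinuousOn (fun p : ℝ × Ed d => f p.1 p.2) (Icc a b ×ˢ closure Ω))
    (hf' : ContinuousOn (fun p : ℝ × Ed d => f' p.1 p.2) (Icc a b ×ˢ closure Ω))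
    (hder : ∀ s ∈ Ioo a b, ∀ x ∈ Ω, HasDerivAt (fun s => f s x) (f' s x) s)
    {t : ℝ} (ht : t ∈ Ioo a b) :
    HasDerivAt (fun s => ∫ x in Ω, f s x) (∫ x in Ω, f' t x) t := by
  obtain ⟨C, hC⟩ := exists_bound_of_continuousOn hb hf'
  have hnhds : Ioo a b ∈ 𝓝 t := Ioo_mem_nhds ht.1 ht.2
  refine (hasDerivAt_integral_of_dominated_loc_of_deriv_le (bound := fun _ => C) hnhds ?_
    (integrableOn_slice hb hf (Ioo_subset_Icc_self ht))
    (integrableOn_slice hb hf' (Ioo_subset_Icc_self ht)).aestronglyMeasurable ?_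
    (integrableOn_const hb.measure_lt_top.ne) ?_).2
  · filter_upwards [hnhds] with s hs
    exact (integrableOn_slice hb hf (Ioo_subset_Icc_self hs)).aestronglyMeasurable
  · exact (ae_restrict_iff' ho.measurableSet).2
      (Eventually.of_forall fun x hx s hs => hC s (Ioo_subset_Icc_self hs) x hx)
  · exact (ae_restrict_iff' ho.measurableSet).2
      (Eventually.of_forall fun x hx s hs => hder s hs x hx)

end Parametric

/-- Joint smoothness in time and space. -/
def JointlySmooth {d : ℕ} (f : ℝ → Ed d → ℝ) : Prop :=
  ContDiff ℝ (⊤ : ℕ∞) fun p : ℝ × Ed d => f p.1 p.2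

namespace JointlySmooth

variable {d : ℕ} {f g : ℝ → Ed d → ℝ}

lemma const (c : ℝ) : JointlySmooth (fun _ (_ : Ed d) => c) := contDiff_const

lemma add (hf : JointlySmooth f) (hg : JointlySmooth g) :
    JointlySmooth fun t x => f t x + g t x := ContDiff.add hf hg

lemma sub (hf : JointlySmooth f) (hg : JointlySmooth g) :
    JointlySmooth fun t x => f t x - g t x := ContDiff.sub hf hg

lemma mul (hf : JointlySmooth f) (hg : JointlySmooth g) :
    JointlySmooth fun t x => f t x * g t x := ContDiff.mul hf hg

lemma const_mul (c : ℝ) (hf : JointlySmooth f) : JointlySmooth fun t x => c * f t x :=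
  (const c).mul hf

lemma sum {ι : Type*} {s : Finset ι} {F : ι → ℝ → Ed d → ℝ} (hF : ∀ i, JointlySmooth (F i)) :
    JointlySmooth fun t x => ∑ i ∈ s, F i t x := ContDiff.sum fun i _ => hF i

lemma hasFDerivAt (hf : JointlySmooth f) (t : ℝ) (x : Ed d) :
    HasFDerivAt (fun p : ℝ × Ed d => f p.1 p.2)
      (fderiv ℝ (fun p : ℝ × Ed d => f p.1 p.2) (t, x)) (t, x) :=
  (ContDiff.differentiable hf (by simp) _).hasFDerivAt

lemma slice (hf : JointlySmooth f) (t : ℝ) : ContDiff ℝ (⊤ : ℕ∞) (f t) :=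
  ContDiff.comp (g := fun p : ℝ × Ed d => f p.1 p.2) hf (contDiff_const.prodMk contDiff_id)

lemma pd_eq (hf : JointlySmooth f) (i : Fin d) (t : ℝ) (x : Ed d) :
    pd i (f t) x = fderiv ℝ (fun p : ℝ × Ed d => f p.1 p.2) (t, x)
      (0, EuclideanSpace.single i 1) := by
  have h := (hf.hasFDerivAt t x).comp x ((hasFDerivAt_const t x).prodMk (hasFDerivAt_id x))
  have e : fderiv ℝ (f t) x = _ := h.fderiv
  rw [pd, e]
  simp

lemma hasDerivAt_time (hf : JointlySmooth f) (t : ℝ) (x : Ed d) :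
    HasDerivAt (fun s => f s x) (fderiv ℝ (fun p : ℝ × Ed d => f p.1 p.2) (t, x) (1, 0)) t := by
  have h := (hf.hasFDerivAt t x).comp_hasDerivAt t
    ((hasDerivAt_id t).prodMk (hasDerivAt_const t x))
  exact h

lemma tder_eq (hf : JointlySmooth f) (t : ℝ) (x : Ed d) :
    tder f t x = fderiv ℝ (fun p : ℝ × Ed d => f p.1 p.2) (t, x) (1, 0) :=
  (hf.hasDerivAt_time t x).deriv

lemma hasDerivAt_tder (hf : JointlySmooth f) (t : ℝ) (x : Ed d) :
    HasDerivAt (fun s => f s x) (tder f t x) t := by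
  rw [hf.tder_eq]
  exact hf.hasDerivAt_time t x

lemma hasDerivAt_pd (hf : JointlySmooth f) (i : Fin d) (t : ℝ) (x : Ed d) :
    HasDerivAt (fun s : ℝ => f t (x + s • EuclideanSpace.single i (1 : ℝ))) (pd i (f t) x) 0 :=
  ((hf.slice t).differentiable (by simp) x).hasFDerivAt.hasLineDerivAt _

lemma fderiv_apply (hf : JointlySmooth f) (v : ℝ × Ed d) :
    ContDiff ℝ (⊤ : ℕ∞) fun p => fderiv ℝ (fun p : ℝ × Ed d => f p.1 p.2) p v :=
  (ContDiff.fderiv_right (m := (⊤ : ℕ∞)) hf (by simp)).clm_apply contDiff_const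

lemma pd (hf : JointlySmooth f) (i : Fin d) : JointlySmooth fun t => pd i (f t) := by
  unfold JointlySmooth
  simp only [hf.pd_eq]
  exact hf.fderiv_apply _

lemma tder (hf : JointlySmooth f) : JointlySmooth (tder f) := by
  unfold JointlySmooth
  simp only [hf.tder_eq]
  exact hf.fderiv_apply _

/-- Time and space derivatives commute. -/
lemma tder_pd (hf : JointlySmooth f) (i : Fin d) (t : ℝ) (x : Ed d) :
    _root_.tder (fun t => _root_.pd i (f t)) t x = _root_.pd i (_root_.tder f t) x := by
  rw [(hf.pd i).tder_eq, hf.tder.pd_eq]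
  simp only [hf.pd_eq, hf.tder_eq]
  have hd : DifferentiableAt ℝ (fderiv ℝ fun p : ℝ × Ed d => f p.1 p.2) (t, x) :=
    (ContDiff.fderiv_right (m := (⊤ : ℕ∞)) hf (by simp)).differentiable (by simp) _
  have happ : ∀ v w : ℝ × Ed d,
      fderiv ℝ (fun p => fderiv ℝ (fun p : ℝ × Ed d => f p.1 p.2) p v) (t, x) w
        = fderiv ℝ (fderiv ℝ fun p : ℝ × Ed d => f p.1 p.2) (t, x) w v := fun v w => by
    rw [fderiv_clm_apply hd (differentiableAt_const v)]
    simp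
  rw [happ, happ]
  have hsymm : IsSymmSndFDerivAt ℝ (fun p : ℝ × Ed d => f p.1 p.2) (t, x) :=
    (ContDiff.contDiffAt hf).isSymmSndFDerivAt (by
      rw [minSmoothness_of_isRCLikeNormedField]
      exact WithTop.coe_le_coe.2 (le_top : (2 : ℕ∞) ≤ ⊤))
  exact hsymm.eq _ _

lemma continuousOn (hf : JointlySmooth f) (K : Set (ℝ × Ed d)) :
    ContinuousOn (fun p : ℝ × Ed d => f p.1 p.2) K := (ContDiff.continuous hf).continuousOn

end JointlySmooth

/-- The double-curl part of the energy balance: antisymmetry of `c` turns the derivative of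
`|curl u|²` into `∑ cᵢⱼ ∂ᵢvⱼ`. -/
lemma sum_mul_sub_swap {ι : Type*} [Fintype ι] {c : ι → ι → ℝ} (hc : ∀ i j, c i j = -c j i)
    (q : ι → ι → ℝ) :
    ∑ i, ∑ j, c i j * (q i j - q j i) = 2 * ∑ i, ∑ j, c i j * q i j := by
  have h : ∑ i, ∑ j, c i j * q j i = -∑ i, ∑ j, c i j * q i j := by
    rw [Finset.sum_comm, ← Finset.sum_neg_distrib]
    refine Finset.sum_congr rfl fun i _ => ?_
    rw [← Finset.sum_neg_distrib]
    refine Finset.sum_congr rfl fun j _ => ?_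
    rw [hc j i]
    ring
  simp only [mul_sub, Finset.sum_sub_distrib]
  rw [h]
  ring

/-- The pointwise energy balance, in terms of the values of the derivatives involved. -/
lemma energy_density_algebra {ι : Type*} [Fintype ι] {c q P : ι → ι → ℝ}
    (hc : ∀ i j, c i j = -c j i) (v D T H : ι → ℝ) (K μ ν D0 θ : ℝ) :
    (∑ i, v i * (K * D i + μ * ∑ k, P k i - ν * T i)) + K * (D0 * ∑ i, q i i)
        + (μ / 2) * (∑ i, ∑ j, c i j * (q i j - q j i)) + (∑ i, H i - ν * θ * ∑ i, q i i)
      = ∑ i, (K * (D i * v i + D0 * q i i) - ν * (T i * v i + θ * q i i) + H i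
          + μ * ∑ j, (P i j * v j + c i j * q i j)) := by
  have h1 : ∑ i, v i * ∑ k, P k i = ∑ i, ∑ j, P i j * v j := by
    simp only [Finset.mul_sum]
    rw [Finset.sum_comm]
    exact Finset.sum_congr rfl fun i _ => Finset.sum_congr rfl fun j _ => mul_comm _ _
  have e1 : ∑ i, v i * (K * D i + μ * ∑ k, P k i - ν * T i)
      = K * ∑ i, D i * v i + μ * ∑ i, v i * ∑ k, P k i - ν * ∑ i, T i * v i := by
    rw [Finset.mul_sum, Finset.mul_sum, Finset.mul_sum, ← Finset.sum_add_distrib,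
      ← Finset.sum_sub_distrib]
    exact Finset.sum_congr rfl fun i _ => by ring
  rw [sum_mul_sub_swap hc, e1, h1]
  simp only [Finset.sum_add_distrib, Finset.sum_sub_distrib, ← Finset.mul_sum]
  ring

lemma hasDerivAt_sq {f : ℝ → ℝ} {a t : ℝ} (h : HasDerivAt f a t) :
    HasDerivAt (fun s => f s ^ 2) (2 * (f t * a)) t := by
  refine (h.fun_pow 2).congr_deriv ?_
  simp [mul_assoc]

namespace IsSolution

variable {d : ℕ} {Ω : Set (Ed d)} {n : Ed d → Ed d} {μ lam ν : ℝ}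
  {u : ℝ → Ed d → Ed d} {θ : ℝ → Ed d → ℝ}

lemma smooth_comp (hsol : IsSolution Ω n μ lam ν u θ) (i : Fin d) :
    JointlySmooth fun t x => u t x i := contDiff_euclidean.1 hsol.smooth_u i

lemma smooth_temp (hsol : IsSolution Ω n μ lam ν u θ) : JointlySmooth θ := hsol.smooth_θ

lemma hasDerivAt_u (hsol : IsSolution Ω n μ lam ν u θ) (t : ℝ) (x : Ed d) :
    HasDerivAt (fun s => u s x) (tder u t x) t := by
  refine DifferentiableAt.hasDerivAt ?_
  exact (hsol.smooth_u.comp (contDiff_id.prodMk contDiff_const)).differentiable (by simp) t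

lemma tder_u_apply (hsol : IsSolution Ω n μ lam ν u θ) (t : ℝ) (x : Ed d) (i : Fin d) :
    tder u t x i = tder (fun t x => u t x i) t x :=
  (((EuclideanSpace.proj (𝕜 := ℝ) i).hasFDerivAt.comp_hasDerivAt t
    (hsol.hasDerivAt_u t x)).deriv).symm

lemma tder_tder_u_apply (hsol : IsSolution Ω n μ lam ν u θ) (t : ℝ) (x : Ed d) (i : Fin d) :
    tder (tder u) t x i = tder (tder fun t x => u t x i) t x := by
  have hsm : ContDiff ℝ (⊤ : ℕ∞) fun s => tder u s x := by
    refine contDiff_euclidean.2 fun j => ?_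
    simp only [hsol.tder_u_apply]
    exact ContDiff.comp (g := fun p : ℝ × Ed d => tder (fun t x => u t x j) p.1 p.2)
      (hsol.smooth_comp j).tder (contDiff_id.prodMk contDiff_const)
  have h := (hsm.differentiable (by simp) t).hasDerivAt
  have h2 := ((EuclideanSpace.proj (𝕜 := ℝ) i).hasFDerivAt.comp_hasDerivAt t h).deriv
  have h3 : (fun s => tder u s x i) = fun s => tder (fun t x => u t x i) s x :=
    funext fun s => hsol.tder_u_apply s x i
  calc tder (tder u) t x i = deriv (fun s => tder u s x i) t := h2.symm
    _ = _ := by rw [h3]; rfl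

/-- The velocity inherits the slip boundary condition. -/
lemma bc_velocity (hsol : IsSolution Ω n μ lam ν u θ) {t : ℝ} (ht : 0 < t) {x : Ed d}
    (hx : x ∈ frontier Ω) : ∑ i, tder (fun t x => u t x i) t x * n x i = 0 := by
  have h : HasDerivAt (fun s => ∑ i, u s x i * n x i)
      (∑ i, tder (fun t x => u t x i) t x * n x i) t :=
    HasDerivAt.fun_sum fun i _ => ((hsol.smooth_comp i).hasDerivAt_tder t x).mul_const _
  have h0 : (fun s => ∑ i, u s x i * n x i) =ᶠ[𝓝 t] fun _ => 0 := by
    filter_upwards [Ioi_mem_nhds ht] with s hs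
    exact hsol.bc_u s hs x hx
  rw [← h.deriv, h0.deriv_eq, deriv_const]

lemma divg_velocity (hsol : IsSolution Ω n μ lam ν u θ) (t : ℝ) (x : Ed d) :
    divg (tder u t) x = ∑ i, pd i (tder (fun t x => u t x i) t) x := by
  simp only [divg, hsol.tder_u_apply]

lemma continuousOn_log (hsol : IsSolution Ω n μ lam ν u θ) (T : ℝ) :
    ContinuousOn (fun p : ℝ × Ed d => Real.log (θ p.1 p.2)) (Icc 0 T ×ˢ closure Ω) :=
  (hsol.smooth_temp.continuousOn _).log fun p hp =>
    (hsol.theta_pos p.1 hp.1.1 p.2 hp.2).ne'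

lemma gradNormSq_log (hsol : IsSolution Ω n μ lam ν u θ) {t : ℝ} {x : Ed d} (hx : 0 < θ t x) :
    gradNormSq (fun y => Real.log (θ t y)) x = ∑ i, (pd i (θ t) x / θ t x) ^ 2 := by
  refine Finset.sum_congr rfl fun i _ => ?_
  have h : HasFDerivAt (fun y => Real.log (θ t y)) _ x :=
    ((hsol.smooth_temp.slice t).differentiable (by simp) x).hasFDerivAt.log hx.ne'
  have e : pd i (fun y => Real.log (θ t y)) x = pd i (θ t) x / θ t x := by
    rw [pd, h.fderiv, pd]
    simp [div_eq_inv_mul]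
  rw [e]

/-- The entropy identity. -/
lemma entropy_identity (hsol : IsSolution Ω n μ lam ν u θ) (hdom : GoodDomain d Ω n)
    {t : ℝ} (ht : 0 < t) :
    HasDerivAt (fun s => ∫ x in Ω, Real.log (θ s x))
      (∫ x in Ω, gradNormSq (fun y => Real.log (θ t y)) x) t := by
  have hθ := hsol.smooth_temp
  have hpos : ∀ {s x}, 0 ≤ s → x ∈ closure Ω → 0 < θ s x := fun hs hx => hsol.theta_pos _ hs _ hx
  have hlogc := hsol.continuousOn_log (t + 1)
  have hder' : ContinuousOn (fun p : ℝ × Ed d => tder θ p.1 p.2 / θ p.1 p.2)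
      (Icc 0 (t + 1) ×ˢ closure Ω) :=
    (hθ.tder.continuousOn _).div (hθ.continuousOn _) fun p hp => (hpos hp.1.1 hp.2).ne'
  have hD := hasDerivAt_setIntegral (f := fun s x => Real.log (θ s x))
    (f' := fun s x => tder θ s x / θ s x) hdom.isOpen hdom.bounded hlogc hder'
    (fun s hs x hx => (hθ.hasDerivAt_tder s x).log (hpos hs.1.le (subset_closure hx)).ne')
    (t := t) ⟨ht, by linarith⟩
  convert hD using 1
  set v : Fin d → Ed d → ℝ := fun i => tder (fun t x => u t x i) t with hv
  set W : Ed d → Ed d := fun x => WithLp.toLp 2 fun i => pd i (θ t) x / θ t x - ν * v i x with hW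
  have hWsm : ContDiffOn ℝ 1 W {x | 0 < θ t x} := by
    rw [contDiffOn_euclidean]
    intro i
    refine ContDiffOn.sub (ContDiffOn.div ?_ ?_ fun x hx => hx.ne') ?_
    · exact (((hθ.pd i).slice t).of_le (by simp)).contDiffOn
    · exact ((hθ.slice t).of_le (by simp)).contDiffOn
    · exact (contDiff_const.mul (((hsol.smooth_comp i).tder.slice t).of_le (by simp))).contDiffOn
  have hzero : ∫ x in Ω, divg W x = 0 := by
    refine hdom.integral_divg_eq_zero (isOpen_lt continuous_const (hθ.slice t).continuous)
      (fun x hx => hpos ht.le hx) hWsm fun x hx => ?_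
    have h1 := hsol.bc_θ t ht x hx
    have h2 := hsol.bc_velocity ht hx
    calc ∑ i, W x i * n x i
        = (θ t x)⁻¹ * ∑ i, pd i (θ t) x * n x i - ν * ∑ i, v i x * n x i := by
          rw [Finset.mul_sum, Finset.mul_sum, ← Finset.sum_sub_distrib]
          exact Finset.sum_congr rfl fun i _ => by simp only [hW]; ring
      _ = 0 := by rw [h1, h2]; ring
  have hdiv : ∀ x ∈ Ω, divg W x
      = tder θ t x / θ t x - gradNormSq (fun y => Real.log (θ t y)) x := by
    intro x hx
    have hp := hpos ht.le (subset_closure hx)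
    have hpd : ∀ i, pd i (fun y => W y i) x
        = pd i (fun y => pd i (θ t) y) x / θ t x - (pd i (θ t) x / θ t x) ^ 2
          - ν * pd i (v i) x := by
      intro i
      have hd : DifferentiableAt ℝ (fun y => W y i) x :=
        ((contDiffOn_euclidean.1 hWsm i).contDiffAt
          ((isOpen_lt continuous_const (hθ.slice t).continuous).mem_nhds hp)).differentiableAt
          one_ne_zero
      have h1 := (((hθ.pd i).hasDerivAt_pd i t x).div (hθ.hasDerivAt_pd i t x)
        (by simpa using hp.ne')).sub
          (((hsol.smooth_comp i).tder.hasDerivAt_pd i t x).const_mul ν)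
      have h2 := (hd.hasFDerivAt.hasLineDerivAt (EuclideanSpace.single i 1)).unique h1
      refine h2.trans ?_
      simp only [zero_smul, add_zero]
      field_simp
      ring
    have hheat := hsol.heat t ht x hx
    rw [hsol.divg_velocity] at hheat
    have ht' : tder θ t x = lap (θ t) x - ν * θ t x * ∑ i, pd i (v i) x := by
      linear_combination hheat
    rw [hsol.gradNormSq_log hp, divg, Finset.sum_congr rfl fun i _ => hpd i, ht', lap,
      Finset.sum_sub_distrib, Finset.sum_sub_distrib, ← Finset.sum_div, ← Finset.mul_sum]
    field_simp
    ring
  have hint1 : IntegrableOn (fun x => tder θ t x / θ t x) Ω :=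
    integrableOn_slice (f := fun s x => tder θ s x / θ s x) hdom.bounded hder'
      ⟨ht.le, by linarith⟩
  have hint2 : IntegrableOn (fun x => gradNormSq (fun y => Real.log (θ t y)) x) Ω := by
    have : ContinuousOn (fun x => ∑ i, (pd i (θ t) x / θ t x) ^ 2) (closure Ω) :=
      continuousOn_finsetSum _ fun i _ =>
        (((hθ.pd i).slice t).continuous.continuousOn.div (hθ.slice t).continuous.continuousOn
          fun x hx => (hpos ht.le hx).ne').pow 2
    refine ((this.integrableOn_compact hdom.bounded.isCompact_closure).mono_set
      subset_closure).congr_fun (fun x hx => ?_) hdom.isOpen.measurableSet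
    exact (hsol.gradNormSq_log (hpos ht.le (subset_closure hx))).symm
  rw [setIntegral_congr_fun hdom.isOpen.measurableSet hdiv, integral_sub hint1 hint2] at hzero
  linarith

/-- The density of the total energy. -/
noncomputable def energyDensity (μ lam : ℝ) (u : ℝ → Ed d → Ed d) (θ : ℝ → Ed d → ℝ)
    (t : ℝ) (x : Ed d) : ℝ :=
  (1 / 2) * (∑ i, (tder u t x i) ^ 2) + ((2 * μ + lam) / 2) * (divg (u t) x) ^ 2
    + (μ / 2) * curlNormSq (u t) x + θ t x

lemma smooth_divg (hsol : IsSolution Ω n μ lam ν u θ) :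
    JointlySmooth fun t x => divg (u t) x :=
  JointlySmooth.sum fun i => (hsol.smooth_comp i).pd i

lemma smooth_curlM (hsol : IsSolution Ω n μ lam ν u θ) (i j : Fin d) :
    JointlySmooth fun t x => curlM (u t) x i j :=
  ((hsol.smooth_comp j).pd i).sub ((hsol.smooth_comp i).pd j)

lemma smooth_tder_sq (hsol : IsSolution Ω n μ lam ν u θ) :
    JointlySmooth fun t x => ∑ i, (tder u t x i) ^ 2 := by
  simp only [hsol.tder_u_apply, sq]
  exact JointlySmooth.sum fun i => (hsol.smooth_comp i).tder.mul (hsol.smooth_comp i).tder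

lemma smooth_divg_sq (hsol : IsSolution Ω n μ lam ν u θ) :
    JointlySmooth fun t x => (divg (u t) x) ^ 2 := by
  simp only [sq]
  exact hsol.smooth_divg.mul hsol.smooth_divg

lemma smooth_curlNormSq (hsol : IsSolution Ω n μ lam ν u θ) :
    JointlySmooth fun t x => curlNormSq (u t) x := by
  simp only [curlNormSq, sq]
  exact JointlySmooth.const_mul _ (JointlySmooth.sum fun i => JointlySmooth.sum fun j =>
    (hsol.smooth_curlM i j).mul (hsol.smooth_curlM i j))

lemma smooth_energyDensity (hsol : IsSolution Ω n μ lam ν u θ) :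
    JointlySmooth (energyDensity μ lam u θ) :=
  (((hsol.smooth_tder_sq.const_mul _).add (hsol.smooth_divg_sq.const_mul _)).add
    (hsol.smooth_curlNormSq.const_mul _)).add hsol.smooth_temp

lemma tder_energyDensity (hsol : IsSolution Ω n μ lam ν u θ) (t : ℝ) (x : Ed d) :
    tder (energyDensity μ lam u θ) t x
      = (∑ i, tder (fun t x => u t x i) t x * tder (tder fun t x => u t x i) t x)
        + (2 * μ + lam) * (divg (u t) x * ∑ i, pd i (tder (fun t x => u t x i) t) x)
        + (μ / 2) * (∑ i, ∑ j, curlM (u t) x i j *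
            (pd i (tder (fun t x => u t x j) t) x - pd j (tder (fun t x => u t x i) t) x))
        + tder θ t x := by
  have hpd : ∀ i j, HasDerivAt (fun s => pd i (fun y => u s y j) x)
      (pd i (tder (fun t x => u t x j) t) x) t := fun i j => by
    rw [← (hsol.smooth_comp j).tder_pd i]
    exact ((hsol.smooth_comp j).pd i).hasDerivAt_tder t x
  have h1 : HasDerivAt (fun s => ∑ i, (tder u s x i) ^ 2)
      (∑ i, 2 * (tder (fun t x => u t x i) t x * tder (tder fun t x => u t x i) t x)) t := by
    simp only [hsol.tder_u_apply]
    refine HasDerivAt.fun_sum fun i _ => ?_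
    exact hasDerivAt_sq ((hsol.smooth_comp i).tder.hasDerivAt_tder t x)
  have h2 : HasDerivAt (fun s => (divg (u s) x) ^ 2)
      (2 * (divg (u t) x * ∑ i, pd i (tder (fun t x => u t x i) t) x)) t := by
    have : HasDerivAt (fun s => divg (u s) x) (∑ i, pd i (tder (fun t x => u t x i) t) x) t :=
      HasDerivAt.fun_sum fun i _ => hpd i i
    exact hasDerivAt_sq this
  have h3 : HasDerivAt (fun s => curlNormSq (u s) x)
      ((1 / 2) * ∑ i, ∑ j, 2 * (curlM (u t) x i j *
        (pd i (tder (fun t x => u t x j) t) x - pd j (tder (fun t x => u t x i) t) x))) t := by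
    refine HasDerivAt.const_mul _ (HasDerivAt.fun_sum fun i _ => HasDerivAt.fun_sum fun j _ => ?_)
    have : HasDerivAt (fun s => curlM (u s) x i j)
        (pd i (tder (fun t x => u t x j) t) x - pd j (tder (fun t x => u t x i) t) x) t :=
      (hpd i j).sub (hpd j i)
    exact hasDerivAt_sq this
  have h := (((h1.const_mul (1 / 2)).add (h2.const_mul ((2 * μ + lam) / 2))).add
    (h3.const_mul (μ / 2))).add (hsol.smooth_temp.hasDerivAt_tder t x)
  refine h.deriv.trans ?_
  simp only [← Finset.mul_sum]
  ring

/-- The total energy flux. -/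
noncomputable def energyFlux (μ lam ν : ℝ) (u : ℝ → Ed d → Ed d) (θ : ℝ → Ed d → ℝ)
    (i : Fin d) (t : ℝ) (x : Ed d) : ℝ :=
  (2 * μ + lam) * (divg (u t) x * tder (fun t x => u t x i) t x)
    - ν * (θ t x * tder (fun t x => u t x i) t x) + pd i (θ t) x
    + μ * ∑ j, curlM (u t) x i j * tder (fun t x => u t x j) t x

lemma smooth_energyFlux (hsol : IsSolution Ω n μ lam ν u θ) (i : Fin d) :
    JointlySmooth (energyFlux μ lam ν u θ i) :=
  ((((hsol.smooth_divg.mul (hsol.smooth_comp i).tder).const_mul _).sub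
    ((hsol.smooth_temp.mul (hsol.smooth_comp i).tder).const_mul _)).add
    (hsol.smooth_temp.pd i)).add ((JointlySmooth.sum fun j =>
      (hsol.smooth_curlM i j).mul (hsol.smooth_comp j).tder).const_mul _)

lemma pd_energyFlux (hsol : IsSolution Ω n μ lam ν u θ) (i : Fin d) (t : ℝ) (x : Ed d) :
    pd i (energyFlux μ lam ν u θ i t) x
      = (2 * μ + lam) * (pd i (divg (u t)) x * tder (fun t x => u t x i) t x
          + divg (u t) x * pd i (tder (fun t x => u t x i) t) x)
        - ν * (pd i (θ t) x * tder (fun t x => u t x i) t x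
          + θ t x * pd i (tder (fun t x => u t x i) t) x)
        + pd i (fun y => pd i (θ t) y) x
        + μ * ∑ j, (pd i (fun y => curlM (u t) y i j) x * tder (fun t x => u t x j) t x
          + curlM (u t) x i j * pd i (tder (fun t x => u t x j) t) x) := by
  have hv := fun j => (hsol.smooth_comp j).tder.hasDerivAt_pd i t x
  have h := (((((hsol.smooth_divg.hasDerivAt_pd i t x).mul (hv i)).const_mul (2 * μ + lam)).sub
    (((hsol.smooth_temp.hasDerivAt_pd i t x).mul (hv i)).const_mul ν)).add
    ((hsol.smooth_temp.pd i).hasDerivAt_pd i t x)).add ((HasDerivAt.fun_sum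
      (u := Finset.univ) fun j _ =>
      ((hsol.smooth_curlM i j).hasDerivAt_pd i t x).mul (hv j)).const_mul μ)
  refine (((hsol.smooth_energyFlux i).hasDerivAt_pd i t x).unique h).trans ?_
  simp only [zero_smul, add_zero]

lemma tder_energyDensity_eq_divg (hsol : IsSolution Ω n μ lam ν u θ) {t : ℝ} (ht : 0 < t)
    {x : Ed d} (hx : x ∈ Ω) :
    tder (energyDensity μ lam u θ) t x = ∑ i, pd i (energyFlux μ lam ν u θ i t) x := by
  have hanti : ∀ y i j, curlM (u t) y i j = -curlM (u t) y j i := fun y i j => by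
    simp only [curlM]; ring
  have hheat := hsol.heat t ht x hx
  rw [hsol.divg_velocity] at hheat
  have hcc : ∀ j, ccurl (u t) x j = -∑ i, pd i (fun y => curlM (u t) y i j) x := by
    intro j
    rw [ccurl, ← Finset.sum_neg_distrib]
    refine Finset.sum_congr rfl fun i _ => ?_
    have e : (fun y => curlM (u t) y j i) = fun y => -curlM (u t) y i j :=
      funext fun y => hanti y j i
    rw [e, pd, pd, fderiv_fun_neg]
    simp
  have hwave : ∀ j, tder (tder fun t x => u t x j) t x
      = (2 * μ + lam) * pd j (divg (u t)) x
        + μ * ∑ i, pd i (fun y => curlM (u t) y i j) x - ν * pd j (θ t) x := by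
    intro j
    have := hsol.wave t ht x hx j
    rw [hsol.tder_tder_u_apply, hcc] at this
    linear_combination this
  have ht' : tder θ t x = ∑ i, pd i (fun y => pd i (θ t) y) x
      - ν * θ t x * ∑ i, pd i (tder (fun t x => u t x i) t) x := by
    rw [lap] at hheat
    linear_combination hheat
  rw [hsol.tder_energyDensity, ht']
  simp only [hwave, hsol.pd_energyFlux]
  exact energy_density_algebra (c := fun i j => curlM (u t) x i j)
    (q := fun i j => pd i (tder (fun t x => u t x j) t) x)
    (P := fun i j => pd i (fun y => curlM (u t) y i j) x) (hanti x) _ _ _ _ _ _ _ _ _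

lemma energyFlux_normal (hsol : IsSolution Ω n μ lam ν u θ) {t : ℝ} (ht : 0 < t)
    {x : Ed d} (hx : x ∈ frontier Ω) : ∑ i, energyFlux μ lam ν u θ i t x * n x i = 0 := by
  have h1 := hsol.bc_velocity ht hx
  have h2 := hsol.bc_θ t ht x hx
  have h3 : ∑ i, (∑ j, curlM (u t) x i j * tder (fun t x => u t x j) t x) * n x i = 0 := by
    simp only [Finset.sum_mul]
    rw [Finset.sum_comm]
    refine Finset.sum_eq_zero fun j _ => ?_
    calc ∑ i, curlM (u t) x i j * tder (fun t x => u t x j) t x * n x i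
        = -tder (fun t x => u t x j) t x * ∑ i, curlM (u t) x j i * n x i := by
          rw [Finset.mul_sum]
          exact Finset.sum_congr rfl fun i _ => by simp only [curlM]; ring
      _ = 0 := by rw [hsol.bc_N t ht x hx j, mul_zero]
  calc ∑ i, energyFlux μ lam ν u θ i t x * n x i
      = ((2 * μ + lam) * divg (u t) x - ν * θ t x)
            * ∑ i, tder (fun t x => u t x i) t x * n x i
          + ∑ i, pd i (θ t) x * n x i
          + μ * ∑ i, (∑ j, curlM (u t) x i j * tder (fun t x => u t x j) t x) * n x i := by
        rw [Finset.mul_sum, Finset.mul_sum, ← Finset.sum_add_distrib, ← Finset.sum_add_distrib]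
        exact Finset.sum_congr rfl fun i _ => by simp only [energyFlux]; ring
    _ = 0 := by rw [h1, h2, h3]; ring

/-- Conservation of the total energy. -/
lemma energy_conservation (hsol : IsSolution Ω n μ lam ν u θ) (hdom : GoodDomain d Ω n)
    {T : ℝ} (hT : 0 ≤ T) :
    ∫ x in Ω, energyDensity μ lam u θ T x = ∫ x in Ω, energyDensity μ lam u θ 0 x := by
  have hsm := hsol.smooth_energyDensity
  have hder : ∀ t ∈ Ioo 0 T, HasDerivAt (fun s => ∫ x in Ω, energyDensity μ lam u θ s x) 0 t := by
    intro t ht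
    have h := hasDerivAt_setIntegral hdom.isOpen hdom.bounded (hsm.continuousOn _)
      (hsm.tder.continuousOn _) (fun s _ x _ => hsm.hasDerivAt_tder s x) ht
    convert h using 1
    rw [setIntegral_congr_fun hdom.isOpen.measurableSet fun x hx =>
      hsol.tder_energyDensity_eq_divg ht.1 hx]
    refine (hdom.integral_divg_eq_zero (W := fun x => WithLp.toLp 2 fun i =>
      energyFlux μ lam ν u θ i t x) isOpen_univ (subset_univ _) ?_ fun x hx =>
        hsol.energyFlux_normal ht.1 hx).symm
    rw [contDiffOn_euclidean]
    exact fun i => (((hsol.smooth_energyFlux i).slice t).of_le (by simp)).contDiffOn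
  have h := intervalIntegral.integral_eq_sub_of_hasDerivAt_of_le hT
    (continuousOn_setIntegral hdom.isOpen hdom.bounded (hsm.continuousOn _)) hder
    intervalIntegrable_const
  rw [intervalIntegral.integral_zero] at h
  linarith

end IsSolution

/-- the entropy identity and the entropy production bound. -/
theorem entropy_identity_and_bound {d : ℕ} {Ω : Set (Ed d)} {n : Ed d → Ed d}
    {μ lam ν : ℝ} {u : ℝ → Ed d → Ed d} {θ : ℝ → Ed d → ℝ}
    (hdom : GoodDomain d Ω n) (hμ : 0 < μ) (hlam : 0 < 2 * μ + (d : ℝ) * lam)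
    (hsol : IsSolution Ω n μ lam ν u θ) :
    (∀ t : ℝ, 0 < t →
      HasDerivAt (fun s => ∫ x in Ω, Real.log (θ s x))
        (∫ x in Ω, gradNormSq (fun y => Real.log (θ t y)) x) t)
    ∧ (∀ t : ℝ, 0 < t →
      (∫ s in (0 : ℝ)..t, ∫ x in Ω, gradNormSq (fun y => Real.log (θ s y)) x)
        ≤ (1 / 2) * (∫ x in Ω, ∑ i, (tder u 0 x i) ^ 2)
          + ((2 * μ + lam) / 2) * (∫ x in Ω, (divg (u 0) x) ^ 2)
          + (μ / 2) * (∫ x in Ω, curlNormSq (u 0) x)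
          + (∫ x in Ω, (θ 0 x - Real.log (θ 0 x)))) := by
  refine ⟨fun t ht => hsol.entropy_identity hdom ht, fun T hT => ?_⟩
  have hpos : ∀ {s x}, 0 ≤ s → x ∈ closure Ω → 0 < θ s x := fun hs hx => hsol.theta_pos _ hs _ hx
  have hsub : ∀ {s x}, 0 ≤ s → x ∈ Ω → 0 < θ s x := fun hs hx => hpos hs (subset_closure hx)
  have hlogc := hsol.continuousOn_log T
  have hcont := continuousOn_setIntegral (f := fun s x => Real.log (θ s x)) hdom.isOpen
    hdom.bounded hlogc
  have hder : ∀ s ∈ Ioo 0 T, HasDerivAt (fun s => ∫ x in Ω, Real.log (θ s x))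
      (∫ x in Ω, gradNormSq (fun y => Real.log (θ s y)) x) s :=
    fun s hs => hsol.entropy_identity hdom hs.1
  have hnonneg : ∀ s ∈ Ioo 0 T, 0 ≤ ∫ x in Ω, gradNormSq (fun y => Real.log (θ s y)) x :=
    fun s _ => integral_nonneg fun x => Finset.sum_nonneg fun i _ => sq_nonneg _
  have hint := intervalIntegral.integrableOn_deriv_of_nonneg hcont hder hnonneg
  have hftc := intervalIntegral.integral_eq_sub_of_hasDerivAt_of_le hT.le hcont hder
    ((intervalIntegrable_iff_integrableOn_Ioc_of_le hT.le).2 hint)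
  rw [hftc]
  have hT0 : (0 : ℝ) ∈ Icc 0 T := ⟨le_rfl, hT.le⟩
  have hTT : T ∈ Icc 0 T := ⟨hT.le, le_rfl⟩
  have hlog : ∀ s ∈ Icc 0 T, IntegrableOn (fun x => Real.log (θ s x)) Ω := fun s hs =>
    integrableOn_slice (f := fun s x => Real.log (θ s x)) hdom.bounded hlogc hs
  have hsm : ∀ {f : ℝ → Ed d → ℝ}, JointlySmooth f → ∀ s, IntegrableOn (f s) Ω := fun hf s =>
    integrableOn_slice (a := s) (b := s) hdom.bounded (hf.continuousOn _) ⟨le_rfl, le_rfl⟩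
  have hθint := hsm hsol.smooth_temp
  have hd1 : (1 : ℝ) ≤ d := by rcases hdom.dims with h | h <;> simp [h]
  have hK : 0 ≤ 2 * μ + lam := by
    rcases le_total 0 lam with h | h <;> nlinarith
  have hle : ∫ x in Ω, Real.log (θ T x) ≤ ∫ x in Ω, IsSolution.energyDensity μ lam u θ T x := by
    refine setIntegral_mono_on (hlog T hTT) (hsm hsol.smooth_energyDensity T)
      hdom.isOpen.measurableSet fun x hx => ?_
    have h1 := Real.log_le_sub_one_of_pos (hsub hT.le hx)
    have h2 : 0 ≤ ∑ i, (tder u T x i) ^ 2 := Finset.sum_nonneg fun i _ => sq_nonneg _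
    have h3 : 0 ≤ ((2 * μ + lam) / 2) * (divg (u T) x) ^ 2 := by positivity
    have h4 : 0 ≤ curlNormSq (u T) x := mul_nonneg (by norm_num)
      (Finset.sum_nonneg fun i _ => Finset.sum_nonneg fun j _ => sq_nonneg _)
    have h5 : 0 ≤ (μ / 2) * curlNormSq (u T) x := by positivity
    unfold IsSolution.energyDensity
    linarith
  rw [hsol.energy_conservation hdom hT.le] at hle
  have hE : ∫ x in Ω, IsSolution.energyDensity μ lam u θ 0 x
      = (1 / 2) * (∫ x in Ω, ∑ i, (tder u 0 x i) ^ 2)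
        + ((2 * μ + lam) / 2) * (∫ x in Ω, (divg (u 0) x) ^ 2)
        + (μ / 2) * (∫ x in Ω, curlNormSq (u 0) x) + ∫ x in Ω, θ 0 x := by
    have i1 := (hsm hsol.smooth_tder_sq 0).const_mul (1 / 2)
    have i2 := (hsm hsol.smooth_divg_sq 0).const_mul ((2 * μ + lam) / 2)
    have i3 := (hsm hsol.smooth_curlNormSq 0).const_mul (μ / 2)
    have j2 : IntegrableOn (fun x => (1 / 2) * ∑ i, (tder u 0 x i) ^ 2
        + ((2 * μ + lam) / 2) * (divg (u 0) x) ^ 2) Ω := i1.add i2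
    have j3 : IntegrableOn (fun x => (1 / 2) * ∑ i, (tder u 0 x i) ^ 2
        + ((2 * μ + lam) / 2) * (divg (u 0) x) ^ 2 + (μ / 2) * curlNormSq (u 0) x) Ω := j2.add i3
    rw [← integral_const_mul, ← integral_const_mul, ← integral_const_mul, ← integral_add i1 i2,
      ← integral_add j2 i3, ← integral_add j3 (hθint 0)]
    rfl
  rw [integral_sub (hθint 0) (hlog 0 hT0)]
  linarith
end

section
/- Let w ∈ C²(Ω̄) be a strictly positive function with ∂w/∂n = 0 on ∂Ω. Then ∫_Ω |∇²(w^{1/2})|² dx ≤ C ∫_Ω w |∇²(log w)|² dx, where C = 1 + (√d)/2 + d/8 and ∇² denotes the Hessian matrix (with |·| the Frobenius norm). -/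
open MeasureTheory Real Filter Set
open scoped Topology

open scoped NNReal

section DivergenceTheorem

variable {d : ℕ} {Ω : Set (Ed d)} {n : Ed d → Ed d}

lemma Ed.sum_mul_eq_inner (a b : Ed d) : ∑ i, a i * b i = inner ℝ a b := by
  simp [PiLp.inner_apply, mul_comm]

namespace GoodDomain

lemma compl_nonempty (h : GoodDomain d Ω n) : Ωᶜ.Nonempty := by
  have : Nontrivial (Ed d) := by
    rcases h.dims with rfl | rfl <;> infer_instance
  rw [Set.nonempty_compl]
  intro hΩ
  exact NormedSpace.unbounded_univ ℝ (Ed d) (hΩ ▸ h.bounded)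

lemma isCompact_closure (h : GoodDomain d Ω n) : IsCompact (closure Ω) :=
  h.bounded.isCompact_closure

lemma infDist_pos (h : GoodDomain d Ω n) {x : Ed d} (hx : x ∈ Ω) :
    0 < Metric.infDist x Ωᶜ :=
  (h.isOpen.isClosed_compl.notMem_iff_infDist_pos h.compl_nonempty).1 (by simpa using hx)

lemma exists_mem_frontier_dist_eq (h : GoodDomain d Ω n) {x : Ed d} (hx : x ∈ Ω) :
    ∃ y ∈ frontier Ω, Metric.infDist x Ωᶜ = dist x y := by
  obtain ⟨y, hy, hxy⟩ := h.isOpen.isClosed_compl.exists_infDist_eq_dist h.compl_nonempty x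
  refine ⟨y, ⟨?_, by rwa [h.isOpen.interior_eq]⟩, hxy⟩
  have hcl := closure_mono (Metric.ball_infDist_compl_subset (s := Ω) (x := x))
  rw [closure_ball x (h.infDist_pos hx).ne'] at hcl
  exact hcl (by rw [Metric.mem_closedBall, dist_comm, hxy])

/-- The distance to the complement is at most the distance to a supporting hyperplane. -/
lemma infDist_le_inner (h : GoodDomain d Ω n) {y z : Ed d} (hy : y ∈ frontier Ω) (hz : z ∈ Ω) :
    Metric.infDist z Ωᶜ ≤ inner ℝ (y - z) (n y) := by
  have hn := h.normal_unit y hy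
  have hout : ∀ q ∈ Ω, inner ℝ (q - y) (n y) ≤ 0 := fun q hq => by
    rw [← Ed.sum_mul_eq_inner]
    exact h.normal_outward y hy q (subset_closure hq)
  have hc : 0 ≤ inner ℝ (y - z) (n y) := by
    rw [← neg_sub, inner_neg_left]
    linarith [hout z hz]
  generalize hceq : inner ℝ (y - z) (n y) = c at hc
  have hq : z + c • n y ∉ Ω := by
    intro hq
    have hlim : Tendsto (fun t : ℝ => z + t • n y) (𝓝[>] c) (𝓝 (z + c • n y)) :=
      (Continuous.tendsto (by fun_prop) c).mono_left nhdsWithin_le_nhds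
    obtain ⟨t, ht, htc⟩ :=
      ((hlim.eventually (h.isOpen.mem_nhds hq)).and self_mem_nhdsWithin).exists
    have := hout _ ht
    rw [show z + t • n y - y = t • n y - (y - z) by abel, inner_sub_left, hceq,
      real_inner_smul_left, real_inner_self_eq_norm_sq, hn] at this
    have htc' : c < t := htc
    linarith
  calc Metric.infDist z Ωᶜ ≤ dist z (z + c • n y) := Metric.infDist_le_dist_of_mem hq
    _ = c := by simp [norm_smul, hn, abs_of_nonneg hc]

/-- Where it is differentiable, the distance to the boundary has gradient `-n y`, with `y` a
nearest boundary point. -/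
lemma exists_fderiv_infDist_eq (h : GoodDomain d Ω n) {x : Ed d} (hx : x ∈ Ω)
    (hdiff : DifferentiableAt ℝ (fun z => Metric.infDist z Ωᶜ) x) :
    ∃ y ∈ frontier Ω, Metric.infDist x Ωᶜ = dist x y ∧
      ∀ v, fderiv ℝ (fun z => Metric.infDist z Ωᶜ) x v = -inner ℝ v (n y) := by
  obtain ⟨y, hy, hxy⟩ := h.exists_mem_frontier_dist_eq hx
  refine ⟨y, hy, hxy, fun v => ?_⟩
  have hle : inner ℝ (y - x) (n y) ≤ Metric.infDist x Ωᶜ := by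
    refine (real_inner_le_norm _ _).trans ?_
    rw [h.normal_unit y hy, mul_one, hxy, dist_comm, dist_eq_norm]
  have hmin : IsLocalMin (fun z => inner ℝ (y - z) (n y) - Metric.infDist z Ωᶜ) x := by
    filter_upwards [h.isOpen.mem_nhds hx] with z hz
    linarith [h.infDist_le_inner hy hz]
  have hinner : HasFDerivAt (fun z : Ed d => inner ℝ (y - z) (n y)) (-(innerSL ℝ (n y))) x := by
    have : (fun z : Ed d => inner ℝ (y - z) (n y))
        = fun z => inner ℝ y (n y) - innerSL ℝ (n y) z := by
      ext z
      rw [inner_sub_left, innerSL_apply_apply, real_inner_comm z]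
    rw [this]
    exact (innerSL ℝ (n y)).hasFDerivAt.const_sub _
  have := congrArg (fun L => L v) (hmin.hasFDerivAt_eq_zero (hinner.sub hdiff.hasFDerivAt))
  simp only [_root_.sub_apply, _root_.neg_apply, innerSL_apply_apply,
    _root_.zero_apply, real_inner_comm v] at this
  linarith

/-- Lipschitz cutoff function tending to the indicator of `Ω`. -/
noncomputable def cutoff {d : ℕ} (Ω : Set (Ed d)) (k : ℕ) (x : Ed d) : ℝ :=
  min 1 (k * Metric.infDist x Ωᶜ)

lemma cutoff_nonneg (k : ℕ) (x : Ed d) : 0 ≤ cutoff Ω k x :=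
  le_min zero_le_one (mul_nonneg k.cast_nonneg Metric.infDist_nonneg)

lemma cutoff_le_one (k : ℕ) (x : Ed d) : cutoff Ω k x ≤ 1 := min_le_left _ _

lemma cutoff_eq_zero (k : ℕ) {x : Ed d} (hx : x ∉ Ω) : cutoff Ω k x = 0 := by
  simp [cutoff, Metric.infDist_zero_of_mem (show x ∈ Ωᶜ from hx)]

lemma lipschitzWith_cutoff (Ω : Set (Ed d)) (k : ℕ) : LipschitzWith k (cutoff Ω k) := by
  have : LipschitzWith k (fun x : Ed d => (k : ℝ) * Metric.infDist x Ωᶜ) := by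
    have := (lipschitzWith_smul (β := ℝ) (k : ℝ)).comp (Metric.lipschitz_infDist_pt Ωᶜ)
    simpa [Function.comp_def] using this
  exact this.const_min 1

lemma hasCompactSupport_cutoff (h : GoodDomain d Ω n) (k : ℕ) : HasCompactSupport (cutoff Ω k) :=
  HasCompactSupport.intro h.isCompact_closure fun _ hx =>
    cutoff_eq_zero k fun hx' => hx (subset_closure hx')

lemma lineDeriv_cutoff_eq_zero_of_notMem (k : ℕ) {x : Ed d} (hx : x ∉ Ω) (v : Ed d) :
    lineDeriv ℝ (cutoff Ω k) x v = 0 := by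
  apply IsLocalMin.deriv_eq_zero
  refine Eventually.of_forall fun t => ?_
  simp only [zero_smul, add_zero, cutoff_eq_zero k hx]
  exact cutoff_nonneg k _

lemma lineDeriv_cutoff_eq_zero_of_one_le {k : ℕ} {x : Ed d}
    (hx : 1 ≤ k * Metric.infDist x Ωᶜ) (v : Ed d) :
    lineDeriv ℝ (cutoff Ω k) x v = 0 := by
  apply IsLocalMax.deriv_eq_zero
  refine Eventually.of_forall fun t => ?_
  have : cutoff Ω k x = 1 := min_eq_left hx
  simp only [zero_smul, add_zero, this]
  exact cutoff_le_one k _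

lemma lineDeriv_cutoff_of_lt_one {k : ℕ} {x : Ed d} (hx : k * Metric.infDist x Ωᶜ < 1)
    (hdiff : DifferentiableAt ℝ (fun z => Metric.infDist z Ωᶜ) x) (v : Ed d) :
    lineDeriv ℝ (cutoff Ω k) x v = k * fderiv ℝ (fun z => Metric.infDist z Ωᶜ) x v := by
  have hcont : Continuous fun z : Ed d => (k : ℝ) * Metric.infDist z Ωᶜ :=
    continuous_const.mul (Metric.continuous_infDist_pt _)
  have heq : cutoff Ω k =ᶠ[𝓝 x] fun z => (k : ℝ) * Metric.infDist z Ωᶜ := by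
    filter_upwards [hcont.continuousAt.eventually (gt_mem_nhds hx)] with z hz
    exact min_eq_right (le_of_lt hz)
  rw [heq.lineDeriv_eq, (hdiff.const_mul (k : ℝ)).lineDeriv_eq_fderiv, fderiv_const_mul hdiff]
  simp

lemma tendsto_cutoff (h : GoodDomain d Ω n) {x : Ed d} (hx : x ∈ Ω) :
    ∀ᶠ k : ℕ in atTop, 1 ≤ k * Metric.infDist x Ωᶜ :=
  (tendsto_natCast_atTop_atTop.atTop_mul_const (h.infDist_pos hx)).eventually_ge_atTop 1

/-- A Lipschitz field tangential to the boundary has bounded flux through the level sets of the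
cutoff functions. -/
lemma abs_sum_mul_lineDeriv_cutoff_le (h : GoodDomain d Ω n) {f : Fin d → Ed d → ℝ}
    {K : Fin d → ℝ≥0} (hf : ∀ i, LipschitzWith (K i) (f i))
    (hbc : ∀ x ∈ frontier Ω, ∑ i, f i x * n x i = 0) (k : ℕ) {x : Ed d} (hx : x ∈ Ω)
    (hdiff : DifferentiableAt ℝ (fun z => Metric.infDist z Ωᶜ) x) :
    |∑ i, lineDeriv ℝ (cutoff Ω k) x (EuclideanSpace.single i 1) * f i x| ≤ ∑ i, (K i : ℝ) := by
  have hM : (0 : ℝ) ≤ ∑ i, (K i : ℝ) := Finset.sum_nonneg fun i _ => (K i).coe_nonneg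
  rcases le_or_gt 1 ((k : ℝ) * Metric.infDist x Ωᶜ) with hk | hk
  · simpa [lineDeriv_cutoff_eq_zero_of_one_le hk] using hM
  obtain ⟨y, hy, hxy, hgrad⟩ := h.exists_fderiv_infDist_eq hx hdiff
  have hflux : |∑ i, f i x * n y i| ≤ (∑ i, (K i : ℝ)) * dist x y := by
    rw [← sub_zero (∑ i, f i x * n y i), ← hbc y hy, ← Finset.sum_sub_distrib, Finset.sum_mul]
    refine (Finset.abs_sum_le_sum_abs _ _).trans (Finset.sum_le_sum fun i _ => ?_)
    rw [← sub_mul, abs_mul]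
    have h1 : |f i x - f i y| ≤ K i * dist x y := (hf i).dist_le_mul x y
    have h2 : |n y i| ≤ 1 := by
      rw [← h.normal_unit y hy]
      exact PiLp.norm_apply_le (n y) i
    calc |f i x - f i y| * |n y i| ≤ (K i * dist x y) * 1 := by gcongr
      _ = _ := mul_one _
  have hsum : ∑ i, lineDeriv ℝ (cutoff Ω k) x (EuclideanSpace.single i 1) * f i x
      = -(k * ∑ i, f i x * n y i) := by
    rw [Finset.mul_sum, ← Finset.sum_neg_distrib]
    refine Finset.sum_congr rfl fun i _ => ?_
    rw [lineDeriv_cutoff_of_lt_one hk hdiff, hgrad, EuclideanSpace.inner_single_left]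
    simp
    ring
  rw [hsum, abs_neg, abs_mul, Nat.abs_cast]
  calc (k : ℝ) * |∑ i, f i x * n y i| ≤ k * ((∑ i, (K i : ℝ)) * dist x y) := by gcongr
    _ = (∑ i, (K i : ℝ)) * (k * Metric.infDist x Ωᶜ) := by rw [hxy]; ring
    _ ≤ ∑ i, (K i : ℝ) := mul_le_of_le_one_right hM hk.le

/-- Divergence theorem for Lipschitz vector fields tangential to the boundary. -/
theorem integral_sum_lineDeriv_eq_zero (h : GoodDomain d Ω n) {f : Fin d → Ed d → ℝ}
    {K : Fin d → ℝ≥0} (hf : ∀ i, LipschitzWith (K i) (f i))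
    (hbc : ∀ x ∈ frontier Ω, ∑ i, f i x * n x i = 0) :
    ∫ x in Ω, ∑ i, lineDeriv ℝ (f i) x (EuclideanSpace.single i 1) = 0 := by
  have hfin : volume Ω ≠ ⊤ := h.bounded.measure_lt_top.ne
  have hmeas : ∀ {g : Ed d → ℝ} (_ : Continuous g) (v : Ed d),
      AEStronglyMeasurable (fun x => lineDeriv ℝ g x v) :=
    fun hg v => aestronglyMeasurable_lineDeriv hg _
  have hbound : ∀ i x, ‖lineDeriv ℝ (f i) x (EuclideanSpace.single i 1)‖ ≤ K i := fun i x => by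
    simpa using norm_lineDeriv_le_of_lipschitz ℝ (hf i) (x₀ := x) (v := EuclideanSpace.single i 1)
  have hcut : ∀ k x, ‖cutoff Ω k x‖ ≤ 1 := fun k x => by
    rw [Real.norm_eq_abs, abs_of_nonneg (cutoff_nonneg k x)]
    exact cutoff_le_one k x
  have hint₁ : ∀ k i, Integrable (fun x => lineDeriv ℝ (f i) x (EuclideanSpace.single i 1)
      * cutoff Ω k x) (volume.restrict Ω) := fun k i => by
    refine Measure.integrableOn_of_bounded hfin ((hmeas (hf i).continuous _).mul
      (lipschitzWith_cutoff Ω k).continuous.aestronglyMeasurable) (M := K i)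
      (Eventually.of_forall fun x => ?_)
    rw [norm_mul]
    exact (mul_le_of_le_one_right (norm_nonneg _) (hcut k x)).trans (hbound i x)
  have hint₂ : ∀ k i, Integrable (fun x => lineDeriv ℝ (cutoff Ω k) x (EuclideanSpace.single i 1)
      * f i x) (volume.restrict Ω) := fun k i => by
    have hfi : IntegrableOn (f i) Ω :=
      ((hf i).continuous.continuousOn.integrableOn_compact h.isCompact_closure).mono_set
        subset_closure
    refine hfi.bdd_mul (hmeas (lipschitzWith_cutoff Ω k).continuous _).restrict (c := k)
      (Eventually.of_forall fun x => ?_)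
    simpa using norm_lineDeriv_le_of_lipschitz ℝ (lipschitzWith_cutoff Ω k) (x₀ := x)
      (v := EuclideanSpace.single i 1)
  have hparts : ∀ k, ∫ x in Ω, (∑ i, lineDeriv ℝ (f i) x (EuclideanSpace.single i 1))
        * cutoff Ω k x
      = -∫ x in Ω, ∑ i, lineDeriv ℝ (cutoff Ω k) x (EuclideanSpace.single i 1) * f i x := by
    intro k
    simp_rw [Finset.sum_mul]
    rw [integral_finsetSum _ fun i _ => hint₁ k i, integral_finsetSum _ fun i _ => hint₂ k i,
      ← Finset.sum_neg_distrib]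
    refine Finset.sum_congr rfl fun i _ => ?_
    rw [setIntegral_eq_integral_of_forall_compl_eq_zero
        fun x hx => by rw [cutoff_eq_zero k hx, mul_zero],
      setIntegral_eq_integral_of_forall_compl_eq_zero
        fun x hx => by rw [lineDeriv_cutoff_eq_zero_of_notMem k hx, zero_mul],
      (hf i).integral_lineDeriv_mul_eq (lipschitzWith_cutoff Ω k) (h.hasCompactSupport_cutoff k),
      ← integral_neg]
    simp_rw [lineDeriv_neg, neg_mul]
  have hlim₁ : Tendsto (fun k => ∫ x in Ω,
      (∑ i, lineDeriv ℝ (f i) x (EuclideanSpace.single i 1)) * cutoff Ω k x) atTop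
      (𝓝 (∫ x in Ω, ∑ i, lineDeriv ℝ (f i) x (EuclideanSpace.single i 1))) := by
    refine tendsto_integral_of_dominated_convergence (fun _ => ∑ i, (K i : ℝ)) (fun k => ?_)
      (integrableOn_const hfin) (fun k => Eventually.of_forall fun x => ?_) ?_
    · exact (Finset.aestronglyMeasurable_fun_sum _ fun i _ =>
        (hmeas (hf i).continuous _).restrict).mul
        (lipschitzWith_cutoff Ω k).continuous.aestronglyMeasurable
    · rw [norm_mul]
      exact (mul_le_of_le_one_right (norm_nonneg _) (hcut k x)).trans
        ((norm_sum_le _ _).trans (Finset.sum_le_sum fun i _ => hbound i x))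
    · refine (ae_restrict_iff' h.isOpen.measurableSet).2 (Eventually.of_forall fun x hx => ?_)
      refine tendsto_const_nhds.congr' ?_
      filter_upwards [h.tendsto_cutoff hx] with k hk
      rw [cutoff, min_eq_left hk, mul_one]
  have hlim₂ : Tendsto (fun k => ∫ x in Ω,
      ∑ i, lineDeriv ℝ (cutoff Ω k) x (EuclideanSpace.single i 1) * f i x) atTop
      (𝓝 (∫ _ in Ω, (0 : ℝ))) := by
    refine tendsto_integral_of_dominated_convergence (fun _ => ∑ i, (K i : ℝ)) (fun k => ?_)
      (integrableOn_const hfin) (fun k => ?_) ?_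
    · exact Finset.aestronglyMeasurable_fun_sum _ fun i _ => (hint₂ k i).aestronglyMeasurable
    · refine (ae_restrict_iff' h.isOpen.measurableSet).2 ?_
      filter_upwards [(Metric.lipschitz_infDist_pt Ωᶜ).ae_differentiableAt] with x hdiff hx
      exact h.abs_sum_mul_lineDeriv_cutoff_le hf hbc k hx hdiff
    · refine (ae_restrict_iff' h.isOpen.measurableSet).2 (Eventually.of_forall fun x hx => ?_)
      refine tendsto_const_nhds.congr' ?_
      filter_upwards [h.tendsto_cutoff hx] with k hk
      simp [lineDeriv_cutoff_eq_zero_of_one_le hk]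
  simp_rw [hparts] at hlim₁
  simpa using tendsto_nhds_unique hlim₁ hlim₂.neg

/-- Divergence theorem for `C¹` vector fields tangential to the boundary. -/
theorem integral_sum_pd_eq_zero (h : GoodDomain d Ω n) {F : Fin d → Ed d → ℝ}
    (hF : ∀ i, ContDiffOn ℝ 1 (F i) (closure Ω))
    (hbc : ∀ x ∈ frontier Ω, ∑ i, F i x * n x i = 0) :
    ∫ x in Ω, ∑ i, pd i (F i) x = 0 := by
  have hext : ∀ i, ∃ (K : ℝ≥0) (g : Ed d → ℝ), LipschitzWith K g ∧ EqOn (F i) g (closure Ω) :=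
    fun i =>
      let ⟨K, hK⟩ := (hF i).exists_lipschitzOnWith one_ne_zero h.convex.closure h.isCompact_closure
      ⟨K, hK.extend_real⟩
  choose K f hf hfF using hext
  rw [← h.integral_sum_lineDeriv_eq_zero hf fun x hx => by
    rw [← hbc x hx]
    exact Finset.sum_congr rfl fun i _ => by rw [hfF i (frontier_subset_closure hx)]]
  refine setIntegral_congr_fun h.isOpen.measurableSet fun x hx => Finset.sum_congr rfl fun i _ => ?_
  have hnhds : closure Ω ∈ 𝓝 x := mem_of_superset (h.isOpen.mem_nhds hx) subset_closure
  rw [← ((hfF i).eventuallyEq_of_mem hnhds).lineDeriv_eq,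
    (((hF i).contDiffAt hnhds).differentiableAt one_ne_zero).lineDeriv_eq_fderiv, pd]

end GoodDomain

end DivergenceTheorem

section PartialDerivatives

variable {d : ℕ} {f g : Ed d → ℝ} {x : Ed d} {i : Fin d}

lemma pd_congr (h : f =ᶠ[𝓝 x] g) : pd i f x = pd i g x := by
  rw [pd, pd, h.fderiv_eq]

lemma pd_mul (hf : DifferentiableAt ℝ f x) (hg : DifferentiableAt ℝ g x) :
    pd i (fun y => f y * g y) x = f x * pd i g x + g x * pd i f x := by
  simp [pd, fderiv_fun_mul hf hg]

lemma pd_comp {φ : ℝ → ℝ} {φ' : ℝ} (hφ : HasDerivAt φ φ' (f x)) (hf : DifferentiableAt ℝ f x) :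
    pd i (fun y => φ (f y)) x = φ' * pd i f x := by
  have : fderiv ℝ (fun y => φ (f y)) x = φ' • fderiv ℝ f x :=
    (hφ.comp_hasFDerivAt x hf.hasFDerivAt).fderiv
  simp [pd, this]

lemma pd_sum {ι : Type*} {s : Finset ι} {F : ι → Ed d → ℝ}
    (hF : ∀ j ∈ s, DifferentiableAt ℝ (F j) x) :
    pd i (fun y => ∑ j ∈ s, F j y) x = ∑ j ∈ s, pd i (F j) x := by
  simp [pd, fderiv_fun_sum hF]

lemma contDiff_pd {m : WithTop ℕ∞} (i : Fin d) (hf : ContDiff ℝ (m + 1) f) :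
    ContDiff ℝ m (pd i f) :=
  (hf.fderiv_right le_rfl).clm_apply contDiff_const

lemma pd_pd_log {w : Ed d → ℝ} (hw : ContDiff ℝ 2 w) (hx : 0 < w x) (i j : Fin d) :
    pd i (fun y => pd j (fun z => Real.log (w z)) y) x
      = pd i (pd j w) x / w x - pd i w x / w x * (pd j w x / w x) := by
  have hwd : Differentiable ℝ w := hw.differentiable two_ne_zero
  have hpd : Differentiable ℝ (pd j w) :=
    (contDiff_pd (m := 1) j (by simpa [one_add_one_eq_two] using hw)).differentiable one_ne_zero
  have heq : (fun y => pd j (fun z => Real.log (w z)) y) =ᶠ[𝓝 x]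
      fun y => (w y)⁻¹ * pd j w y := by
    filter_upwards [hw.continuous.continuousAt.eventually (lt_mem_nhds hx)] with y hy
    exact pd_comp (Real.hasDerivAt_log hy.ne') hwd.differentiableAt
  rw [pd_congr heq, pd_mul (hwd.differentiableAt.fun_inv hx.ne') hpd.differentiableAt,
    pd_comp (hasDerivAt_inv hx.ne') hwd.differentiableAt]
  field_simp
  ring

lemma pd_pd_sqrt {w : Ed d → ℝ} (hw : ContDiff ℝ 2 w) (hx : 0 < w x) (i j : Fin d) :
    pd i (fun y => pd j (fun z => Real.sqrt (w z)) y) x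
      = Real.sqrt (w x) * ((pd i (pd j w) x / w x - pd i w x / w x * (pd j w x / w x)) / 2
        + pd i w x / w x * (pd j w x / w x) / 4) := by
  have hwd : Differentiable ℝ w := hw.differentiable two_ne_zero
  have hpd : Differentiable ℝ (pd j w) :=
    (contDiff_pd (m := 1) j (by simpa [one_add_one_eq_two] using hw)).differentiable one_ne_zero
  have heq : (fun y => pd j (fun z => Real.sqrt (w z)) y) =ᶠ[𝓝 x]
      fun y => (2 * Real.sqrt (w y))⁻¹ * pd j w y := by
    filter_upwards [hw.continuous.continuousAt.eventually (lt_mem_nhds hx)] with y hy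
    rw [pd_comp (Real.hasDerivAt_sqrt hy.ne') hwd.differentiableAt, one_div]
  have hs : 0 < Real.sqrt (w x) := Real.sqrt_pos.2 hx
  have hder : HasDerivAt (fun t => (2 * Real.sqrt t)⁻¹)
      (-(2 * (1 / (2 * Real.sqrt (w x)))) / (2 * Real.sqrt (w x)) ^ 2) (w x) :=
    ((Real.hasDerivAt_sqrt hx.ne').const_mul 2).fun_inv (by positivity)
  have hinv : DifferentiableAt ℝ (fun y => (2 * Real.sqrt (w y))⁻¹) x :=
    hder.differentiableAt.comp x hwd.differentiableAt
  rw [pd_congr heq, pd_mul hinv hpd.differentiableAt, pd_comp hder hwd.differentiableAt]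
  have hsq : w x = Real.sqrt (w x) ^ 2 := (Real.sq_sqrt hx.le).symm
  generalize Real.sqrt (w x) = s at hs hsq
  rw [hsq]
  field_simp
  ring

end PartialDerivatives

section Inequality

variable {d : ℕ}

/-- With `H = ∇²w / w` and `a = ∇w / w`, the algebraic inequality behind
`|∇²√w|² ≤ C w |∇² log w|² + div (w |a|² a) / 8`. -/
lemma sum_sq_hessian_le {C : ℝ} (hC : 1 / 4 + (d : ℝ) / 16 ≤ C) (a : Fin d → ℝ)
    (H : Fin d → Fin d → ℝ) :
    ∑ i, ∑ j, ((H i j - a i * a j) / 2 + a i * a j / 4) ^ 2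
      ≤ C * ∑ i, ∑ j, (H i j - a i * a j) ^ 2
        + 1 / 8 * ∑ i, ((∑ j, a j ^ 2) * H i i + 2 * (∑ j, a j * H i j) * a i
          - 2 * (∑ j, a j ^ 2) * a i ^ 2) := by
  set q := ∑ j, a j ^ 2 with hq
  obtain ⟨U, hU⟩ : ∃ U : Fin d → Fin d → ℝ, ∀ i j, H i j = U i j + a i * a j :=
    ⟨fun i j => H i j - a i * a j, fun i j => by ring⟩
  simp_rw [hU, add_sub_cancel_right]
  set A := ∑ i, ∑ j, U i j ^ 2 with hA
  set X := ∑ i, ∑ j, U i j * a i * a j with hX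
  set T := ∑ i, U i i with hT
  have hqq : ∑ i, ∑ j, (a i * a j) ^ 2 = q ^ 2 := by
    simp_rw [mul_pow, ← Finset.mul_sum, ← Finset.sum_mul, ← hq, sq]
  have hlhs : ∑ i, ∑ j, (U i j / 2 + a i * a j / 4) ^ 2 = A / 4 + X / 4 + q ^ 2 / 16 := by
    rw [← hqq, hA, hX]
    simp_rw [Finset.sum_div, ← Finset.sum_add_distrib]
    refine Finset.sum_congr rfl fun i _ => Finset.sum_congr rfl fun j _ => ?_
    ring
  have hdiv : ∑ i, (q * (U i i + a i * a i) + 2 * (∑ j, a j * (U i j + a i * a j)) * a i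
      - 2 * q * a i ^ 2) = q * T + 2 * X + q ^ 2 := by
    have hinner : ∀ i, (∑ j, a j * (U i j + a i * a j)) * a i
        = (∑ j, U i j * a i * a j) + q * a i ^ 2 := fun i => by
      rw [hq, Finset.sum_mul, Finset.sum_mul, ← Finset.sum_add_distrib]
      exact Finset.sum_congr rfl fun j _ => by ring
    calc _ = ∑ i, (q * U i i + 2 * (∑ j, U i j * a i * a j) + q * a i ^ 2) :=
          Finset.sum_congr rfl fun i _ => by rw [mul_assoc 2, hinner]; ring
      _ = _ := by
        rw [Finset.sum_add_distrib, Finset.sum_add_distrib, ← Finset.mul_sum, ← Finset.mul_sum,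
          ← Finset.mul_sum, ← hq, sq]
  have htrace : T ^ 2 ≤ d * A := by
    calc T ^ 2 ≤ d * ∑ i, U i i ^ 2 := by
          simpa using sq_sum_le_card_mul_sum_sq (s := Finset.univ) (f := fun i => U i i)
      _ ≤ d * A := by
        refine mul_le_mul_of_nonneg_left (Finset.sum_le_sum fun i _ => ?_) d.cast_nonneg
        exact Finset.single_le_sum (f := fun j => U i j ^ 2) (fun j _ => sq_nonneg _)
          (Finset.mem_univ i)
  have hA0 : 0 ≤ A := Finset.sum_nonneg fun i _ => Finset.sum_nonneg fun j _ => sq_nonneg _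
  rw [hlhs, hdiv]
  nlinarith [mul_le_mul_of_nonneg_right hC hA0, sq_nonneg (q + T)]

end Inequality

section MainProof

variable {d : ℕ}

/-- The `i`-th component of the vector field `w |∇ log w|² ∇ log w`. -/
noncomputable def fisherField (w : Ed d → ℝ) (i : Fin d) (x : Ed d) : ℝ :=
  (∑ j, pd j w x * pd j w x) * pd i w x * (w x * w x)⁻¹

lemma pd_fisherField {w : Ed d → ℝ} {x : Ed d} (hw : ContDiff ℝ 2 w) (hx : 0 < w x)
    (i : Fin d) :
    pd i (fisherField w i) x = w x * ((∑ j, (pd j w x / w x) ^ 2) * (pd i (pd i w) x / w x)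
      + 2 * (∑ j, pd j w x / w x * (pd i (pd j w) x / w x)) * (pd i w x / w x)
      - 2 * (∑ j, (pd j w x / w x) ^ 2) * (pd i w x / w x) ^ 2) := by
  have hwd : DifferentiableAt ℝ w x := hw.differentiable two_ne_zero x
  have hpd : ∀ j, DifferentiableAt ℝ (pd j w) x := fun j =>
    (contDiff_pd (m := 1) j (by simpa [one_add_one_eq_two] using hw)).differentiable one_ne_zero x
  have hsq : ∀ j, DifferentiableAt ℝ (fun y => pd j w y * pd j w y) x := fun j =>
    (hpd j).fun_mul (hpd j)
  have hsum : DifferentiableAt ℝ (fun y => ∑ j, pd j w y * pd j w y) x :=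
    DifferentiableAt.fun_sum fun j _ => hsq j
  have hww : DifferentiableAt ℝ (fun y => w y * w y) x := hwd.fun_mul hwd
  have hne : w x * w x ≠ 0 := by positivity
  have hpdsum : pd i (fun y => ∑ j, pd j w y * pd j w y) x
      = 2 * ∑ j, pd j w x * pd i (pd j w) x := by
    rw [pd_sum fun j _ => hsq j, Finset.mul_sum]
    exact Finset.sum_congr rfl fun j _ => by rw [pd_mul (hpd j) (hpd j)]; ring
  unfold fisherField
  rw [pd_mul (hsum.fun_mul (hpd i)) (hww.fun_inv hne), pd_mul hsum (hpd i),
    pd_comp (hasDerivAt_inv hne) hww, pd_mul hwd hwd, hpdsum]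
  have h1 : ∑ j, (pd j w x / w x) ^ 2 = (∑ j, pd j w x * pd j w x) / w x ^ 2 := by
    rw [Finset.sum_div]
    exact Finset.sum_congr rfl fun j _ => by rw [div_pow, sq]
  have h2 : ∑ j, pd j w x / w x * (pd i (pd j w) x / w x)
      = (∑ j, pd j w x * pd i (pd j w) x) / w x ^ 2 := by
    rw [Finset.sum_div]
    exact Finset.sum_congr rfl fun j _ => by rw [div_mul_div_comm, sq]
  rw [h1, h2]
  field_simp
  ring

lemma hessNormSq_sqrt {w : Ed d → ℝ} {x : Ed d} (hw : ContDiff ℝ 2 w) (hx : 0 < w x) :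
    hessNormSq (fun y => Real.sqrt (w y)) x
      = w x * ∑ i, ∑ j, ((pd i (pd j w) x / w x - pd i w x / w x * (pd j w x / w x)) / 2
        + pd i w x / w x * (pd j w x / w x) / 4) ^ 2 := by
  simp_rw [hessNormSq, pd_pd_sqrt hw hx, mul_pow, Real.sq_sqrt hx.le, Finset.mul_sum]

lemma hessNormSq_log {w : Ed d → ℝ} {x : Ed d} (hw : ContDiff ℝ 2 w) (hx : 0 < w x) :
    hessNormSq (fun y => Real.log (w y)) x
      = ∑ i, ∑ j, (pd i (pd j w) x / w x - pd i w x / w x * (pd j w x / w x)) ^ 2 := by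
  simp_rw [hessNormSq, pd_pd_log hw hx]

end MainProof

/-- `∫ |∇²(w^{1/2})|² ≤ (1 + √d/2 + d/8) ∫ w |∇² log w|²` for positive
Neumann functions. -/
theorem hessian_sqrt_le_fisher {d : ℕ} {Ω : Set (Ed d)} {n : Ed d → Ed d}
    (hdom : GoodDomain d Ω n) (w : Ed d → ℝ) (hw : ContDiff ℝ 2 w)
    (hpos : ∀ x ∈ closure Ω, 0 < w x)
    (hbc : ∀ x ∈ frontier Ω, ∑ i, pd i w x * n x i = 0) :
    (∫ x in Ω, hessNormSq (fun y => Real.sqrt (w y)) x)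
      ≤ (1 + Real.sqrt d / 2 + (d : ℝ) / 8)
        * ∫ x in Ω, w x * hessNormSq (fun y => Real.log (w y)) x := by
  set C : ℝ := 1 + Real.sqrt d / 2 + (d : ℝ) / 8 with hC
  have hC' : 1 / 4 + (d : ℝ) / 16 ≤ C := by
    have : (0 : ℝ) ≤ d := d.cast_nonneg
    have := Real.sqrt_nonneg (d : ℝ)
    linarith
  have hposΩ : ∀ x ∈ Ω, 0 < w x := fun x hx => hpos x (subset_closure hx)
  have hwc : ContinuousOn w (closure Ω) := hw.continuous.continuousOn
  have hpd : ∀ i, ContDiff ℝ 1 (pd i w) := fun i =>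
    contDiff_pd i (by simpa [one_add_one_eq_two] using hw)
  have hpdc : ∀ i, ContinuousOn (pd i w) (closure Ω) := fun i => (hpd i).continuous.continuousOn
  have hpdpdc : ∀ i j, ContinuousOn (pd i (pd j w)) (closure Ω) := fun i j =>
    (contDiff_pd (m := 0) i (by simpa using hpd j)).continuous.continuousOn
  have hne : ∀ x ∈ closure Ω, w x ≠ 0 := fun x hx => (hpos x hx).ne'
  have hdiv : ∫ x in Ω, ∑ i, pd i (fisherField w i) x = 0 := by
    refine hdom.integral_sum_pd_eq_zero (fun i => ?_) fun x hx => ?_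
    · refine ContDiffOn.mul (ContDiff.contDiffOn ?_) (ContDiffOn.inv (ContDiff.contDiffOn ?_)
        fun x hx => mul_ne_zero (hne x hx) (hne x hx))
      · exact (ContDiff.sum fun j _ => (hpd j).mul (hpd j)).mul (hpd i)
      · exact (hw.mul hw).of_le one_le_two
    · calc ∑ i, fisherField w i x * n x i
          = (∑ j, pd j w x * pd j w x) * (w x * w x)⁻¹ * ∑ i, pd i w x * n x i := by
            rw [Finset.mul_sum]
            exact Finset.sum_congr rfl fun i _ => by rw [fisherField]; ring
        _ = 0 := by rw [hbc x hx, mul_zero]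
  have hintOn : ∀ {g G : Ed d → ℝ}, ContinuousOn G (closure Ω) → EqOn g G Ω →
      IntegrableOn g Ω := fun hG hgG =>
    ((hG.integrableOn_compact hdom.isCompact_closure).mono_set subset_closure).congr_fun
      hgG.symm hdom.isOpen.measurableSet
  have hint_log : IntegrableOn (fun x => w x * hessNormSq (fun y => Real.log (w y)) x) Ω := by
    refine hintOn ?_ fun x hx => congrArg (w x * ·) (hessNormSq_log hw (hposΩ x hx))
    fun_prop (disch := assumption)
  have hint_div : IntegrableOn (fun x => ∑ i, pd i (fisherField w i) x) Ω := by
    refine hintOn ?_ fun x hx => Finset.sum_congr rfl fun i _ => pd_fisherField hw (hposΩ x hx) i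
    fun_prop (disch := assumption)
  calc ∫ x in Ω, hessNormSq (fun y => Real.sqrt (w y)) x
      ≤ ∫ x in Ω, (C * (w x * hessNormSq (fun y => Real.log (w y)) x)
          + 1 / 8 * ∑ i, pd i (fisherField w i) x) := by
        refine integral_mono_of_nonneg (Eventually.of_forall fun x => Finset.sum_nonneg fun i _ =>
          Finset.sum_nonneg fun j _ => sq_nonneg _)
          ((hint_log.const_mul C).add (hint_div.const_mul (1 / 8)))
          ((ae_restrict_iff' hdom.isOpen.measurableSet).2 (Eventually.of_forall fun x hx => ?_))
        have hx' := hposΩ x hx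
        simp only [hessNormSq_sqrt hw hx', hessNormSq_log hw hx', pd_fisherField hw hx',
          ← Finset.mul_sum]
        rw [mul_left_comm C, mul_left_comm (1 / 8 : ℝ), ← mul_add]
        exact mul_le_mul_of_nonneg_left (sum_sq_hessian_le hC' (fun i => pd i w x / w x)
          fun i j => pd i (pd j w) x / w x) hx'.le
    _ = C * ∫ x in Ω, w x * hessNormSq (fun y => Real.log (w y)) x := by
        rw [integral_add (hint_log.const_mul C) (hint_div.const_mul (1 / 8)),
          integral_const_mul, integral_const_mul, hdiv, mul_zero, add_zero]
end
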